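/- Let K(C2) be the set of real numbers [0; a1, a2, …] whose continued fraction partial quotients all lie in {1,2,3} and whose digit sequence contains neither 13 nor 31 as a consecutive substring. Then dim_H((M \ L) ∩ (√13, 3.84)) ≤ dim_H K(C2) < 0.574, where M and L are the Markov and Lagrange spectra. -/

import Mathlib

open Filter

/-- Numerators of the convergents of the continued fraction `[a 0; a 1, a 2, …]`. -/
def cfNum (a : ℕ → ℕ) : ℕ → ℕ
  | 0 => a 0
  | 1 => a 1 * a 0 + 1
  | n + 2 => a (n + 2) * cfNum a (n + 1) + cfNum a n

/-- Denominators of the convergents of the continued fraction `[a 0; a 1, a 2, …]`. -/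
def cfDen (a : ℕ → ℕ) : ℕ → ℕ
  | 0 => 1
  | 1 => a 1
  | n + 2 => a (n + 2) * cfDen a (n + 1) + cfDen a n

/-- Value of the infinite continued fraction `[a 0; a 1, a 2, …]` (the limit of its
convergents). -/
noncomputable def cfVal (a : ℕ → ℕ) : ℝ :=
  limUnder atTop fun n => (cfNum a n : ℝ) / (cfDen a n)

/-- Value of the infinite continued fraction `[0; a 0, a 1, …]`. -/
noncomputable def cf01 (a : ℕ → ℕ) : ℝ := 1 / cfVal a

/-- `λ₀(α) = [α 0; α 1, α 2, …] + [0; α (-1), α (-2), …]`. -/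
noncomputable def lambda0 (α : ℤ → ℕ) : ℝ :=
  cfVal (fun n : ℕ => α (n : ℤ)) + cf01 (fun n : ℕ => α (-((n : ℤ) + 1)))

/-- The shift `σ^N` on bi-infinite sequences. -/
def shiftZ (N : ℤ) (α : ℤ → ℕ) : ℤ → ℕ := fun i => α (i + N)

/-- The Markov value `m(α) = sup_{n ∈ ℤ} λ₀(σⁿ α)`. -/
noncomputable def markovValue (α : ℤ → ℕ) : ℝ := ⨆ n : ℤ, lambda0 (shiftZ n α)

/-- The Lagrange value `ℓ(α) = limsup_{n → +∞} λ₀(σⁿ α)`. -/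
noncomputable def lagrangeValue (α : ℤ → ℕ) : ℝ :=
  limsup (fun n : ℕ => lambda0 (shiftZ (n : ℤ) α)) atTop

/-- The Markov spectrum `M`. -/
def MarkovSpectrum : Set ℝ :=
  { x | ∃ α : ℤ → ℕ, (∀ i, 1 ≤ α i) ∧ markovValue α = x }

/-- The Lagrange spectrum `L`. -/
def LagrangeSpectrum : Set ℝ :=
  { x | ∃ α : ℤ → ℕ, (∀ i, 1 ≤ α i) ∧ lagrangeValue α = x }

/-- The finite word `w` occurs in the one-sided sequence `a` starting at position `i`. -/
def occursAtN (a : ℕ → ℕ) (i : ℕ) (w : List ℕ) : Prop :=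
  ∀ j < w.length, a (i + j) = w.getD j 0

/-- The Gauss–Cantor set of reals `[0; a₁, a₂, …]` whose partial quotients all lie in `D`
and whose digit sequence contains no word of `F`, nor the reverse of a word of `F`, as a
consecutive substring. -/
noncomputable def gaussCantorRev (D : Set ℕ) (F : List (List ℕ)) : Set ℝ :=
  { x | ∃ a : ℕ → ℕ, (∀ n, a n ∈ D) ∧
      (∀ w ∈ F, ∀ i, ¬ occursAtN a i w ∧ ¬ occursAtN a i w.reverse) ∧ x = cf01 a }

/-- The Gauss–Cantor set of reals `[0; a₁, a₂, …]` whose partial quotients all lie in `D`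
and whose digit sequence contains no word of `F` as a consecutive substring. -/
noncomputable def gaussCantor (D : Set ℕ) (F : List (List ℕ)) : Set ℝ :=
  { x | ∃ a : ℕ → ℕ, (∀ n, a n ∈ D) ∧ (∀ w ∈ F, ∀ i, ¬ occursAtN a i w) ∧ x = cf01 a }

/-- The forbidden words defining the Gauss–Cantor set `K(C₂)`. -/
def forbiddenC2 : List (List ℕ) := [[1, 3], [3, 1]]

/-! ### Convergence and the recursion of infinite continued fractions -/

lemma cfNum_cfDen_succ (a : ℕ → ℕ) (n : ℕ) :
    cfNum a (n + 1) = a 0 * cfNum (fun k => a (k + 1)) n + cfDen (fun k => a (k + 1)) n ∧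
      cfDen a (n + 1) = cfNum (fun k => a (k + 1)) n := by
  induction n using Nat.strong_induction_on with
  | _ n ih =>
    match n with
    | 0 => simp [cfNum, cfDen, mul_comm]
    | 1 => simp [cfNum, cfDen]; ring
    | n + 2 =>
      have h1 := ih (n + 1) (by omega)
      have h0 := ih n (by omega)
      refine ⟨?_, ?_⟩
      · rw [cfNum, h1.1, h0.1]
        simp only [cfNum, cfDen]
        ring
      · rw [cfDen, h1.2, h0.2]
        simp only [cfNum]

lemma cfDen_pos_le_cfNum {a : ℕ → ℕ} (ha : ∀ n, 1 ≤ a n) (n : ℕ) :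
    1 ≤ cfDen a n ∧ cfDen a n ≤ cfNum a n := by
  induction n using Nat.strong_induction_on with
  | _ n ih =>
    match n with
    | 0 => simpa [cfNum, cfDen] using ha 0
    | 1 =>
      refine ⟨ha 1, ?_⟩
      simp only [cfNum, cfDen]
      nlinarith [ha 0, ha 1]
    | n + 2 =>
      have h1 := ih (n + 1) (by omega)
      have h0 := ih n (by omega)
      simp only [cfNum, cfDen]
      exact ⟨by omega, add_le_add (Nat.mul_le_mul_left _ h1.2) h0.2⟩

lemma one_le_convergent {a : ℕ → ℕ} (ha : ∀ n, 1 ≤ a n) (n : ℕ) :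
    (1 : ℝ) ≤ (cfNum a n : ℝ) / cfDen a n := by
  obtain ⟨h1, h2⟩ := cfDen_pos_le_cfNum ha n
  rw [le_div_iff₀ (by exact_mod_cast h1)]
  exact_mod_cast (by simpa using h2)

lemma convergent_succ {a : ℕ → ℕ} (ha : ∀ n, 1 ≤ a n) (n : ℕ) :
    (cfNum a (n + 1) : ℝ) / cfDen a (n + 1) =
      a 0 + 1 / ((cfNum (fun k => a (k + 1)) n : ℝ) / cfDen (fun k => a (k + 1)) n) := by
  obtain ⟨h1, h2⟩ := cfDen_pos_le_cfNum (a := fun k => a (k + 1)) (fun k => ha _) n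
  have hp : (0 : ℝ) < cfNum (fun k => a (k + 1)) n := by exact_mod_cast (by omega)
  rw [(cfNum_cfDen_succ a n).1, (cfNum_cfDen_succ a n).2]
  push_cast
  field_simp

lemma convergent_mem_Icc {a : ℕ → ℕ} (ha : ∀ n, 1 ≤ a n) (n : ℕ) :
    (cfNum a n : ℝ) / cfDen a n ∈ Set.Icc (a 0 : ℝ) (a 0 + 1) := by
  cases n with
  | zero => simp [cfNum, cfDen]
  | succ n =>
    rw [convergent_succ ha]
    have h := one_le_convergent (a := fun k => a (k + 1)) (fun k => ha _) n
    have h' : 1 / ((cfNum (fun k => a (k + 1)) n : ℝ) / cfDen (fun k => a (k + 1)) n) ≤ 1 := by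
      rw [div_le_one (by linarith)]; exact h
    have h'' : 0 ≤ 1 / ((cfNum (fun k => a (k + 1)) n : ℝ) / cfDen (fun k => a (k + 1)) n) := by
      positivity
    constructor <;> linarith

lemma abs_convergent_sub_le {a : ℕ → ℕ} (ha : ∀ n, 1 ≤ a n) (k n m : ℕ) :
    |(cfNum a (n + 2 * k) : ℝ) / cfDen a (n + 2 * k) -
      (cfNum a (m + 2 * k) : ℝ) / cfDen a (m + 2 * k)| ≤ (1 / 4) ^ k := by
  induction k generalizing a with
  | zero =>
    have h1 := convergent_mem_Icc ha n
    have h2 := convergent_mem_Icc ha m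
    simp only [mul_zero, add_zero, pow_zero, abs_le]
    constructor <;> linarith [h1.1, h1.2, h2.1, h2.2]
  | succ k ih =>
    have ih' := ih (a := fun j => a (j + 1 + 1)) (fun j => ha _)
    have e : ∀ i, i + 2 * (k + 1) = (i + 2 * k) + 1 + 1 := fun i => by ring
    rw [e n, e m, convergent_succ ha, convergent_succ ha,
      convergent_succ (a := fun j => a (j + 1)) (fun j => ha _),
      convergent_succ (a := fun j => a (j + 1)) (fun j => ha _)]
    set x := (cfNum (fun j => a (j + 1 + 1)) (n + 2 * k) : ℝ) /
      cfDen (fun j => a (j + 1 + 1)) (n + 2 * k) with hx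
    set y := (cfNum (fun j => a (j + 1 + 1)) (m + 2 * k) : ℝ) /
      cfDen (fun j => a (j + 1 + 1)) (m + 2 * k) with hy
    have hx1 : 1 ≤ x := one_le_convergent (a := fun j => a (j + 1 + 1)) (fun j => ha _) _
    have hy1 : 1 ≤ y := one_le_convergent (a := fun j => a (j + 1 + 1)) (fun j => ha _) _
    have hb : (1 : ℝ) ≤ a (0 + 1) := by exact_mod_cast ha _
    have key : (a 0 + 1 / ((a (0 + 1) : ℝ) + 1 / x)) - (a 0 + 1 / ((a (0 + 1) : ℝ) + 1 / y)) =
        (x - y) / ((a (0 + 1) * x + 1) * (a (0 + 1) * y + 1)) := by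
      field_simp
      ring
    rw [key, abs_div, pow_succ]
    have h2 : (4 : ℝ) ≤ (a (0 + 1) * x + 1) * (a (0 + 1) * y + 1) := by
      have : (2 : ℝ) ≤ a (0 + 1) * x + 1 := by nlinarith
      have : (2 : ℝ) ≤ a (0 + 1) * y + 1 := by nlinarith
      nlinarith
    rw [abs_of_pos (by linarith : (0 : ℝ) < (a (0 + 1) * x + 1) * (a (0 + 1) * y + 1)),
      div_le_iff₀ (by linarith)]
    have h3 : (0 : ℝ) ≤ (1 / 4) ^ k := by positivity
    nlinarith

lemma tendsto_cfVal {a : ℕ → ℕ} (ha : ∀ n, 1 ≤ a n) :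
    Tendsto (fun n => (cfNum a n : ℝ) / cfDen a n) atTop (nhds (cfVal a)) := by
  apply CauchySeq.tendsto_limUnder
  rw [Metric.cauchySeq_iff]
  intro ε hε
  obtain ⟨k, hk⟩ := exists_pow_lt_of_lt_one hε (by norm_num : (1 / 4 : ℝ) < 1)
  refine ⟨2 * k, fun n hn m hm => ?_⟩
  obtain ⟨n, rfl⟩ := Nat.exists_eq_add_of_le' hn
  obtain ⟨m, rfl⟩ := Nat.exists_eq_add_of_le' hm
  exact (abs_convergent_sub_le ha k n m).trans_lt hk

lemma one_le_cfVal {a : ℕ → ℕ} (ha : ∀ n, 1 ≤ a n) : 1 ≤ cfVal a :=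
  ge_of_tendsto' (tendsto_cfVal ha) (one_le_convergent ha)

lemma cfVal_eq {a : ℕ → ℕ} (ha : ∀ n, 1 ≤ a n) :
    cfVal a = a 0 + cf01 (fun n => a (n + 1)) := by
  have ht : ∀ n, 1 ≤ (fun n => a (n + 1)) n := fun n => ha _
  have h1 := (tendsto_add_atTop_iff_nat 1).2 (tendsto_cfVal ha)
  have h2 : Tendsto (fun n => (a 0 : ℝ) +
      1 / ((cfNum (fun k => a (k + 1)) n : ℝ) / cfDen (fun k => a (k + 1)) n)) atTop
      (nhds (a 0 + 1 / cfVal (fun n => a (n + 1)))) :=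
    tendsto_const_nhds.add (tendsto_const_nhds.div (tendsto_cfVal ht)
      (by linarith [one_le_cfVal ht]))
  exact tendsto_nhds_unique (h1.congr fun n => convergent_succ ha n) h2

lemma cf01_pos {a : ℕ → ℕ} (ha : ∀ n, 1 ≤ a n) : 0 < cf01 a := by
  have := one_le_cfVal ha
  unfold cf01
  positivity

lemma cf01_eq {a : ℕ → ℕ} (ha : ∀ n, 1 ≤ a n) :
    cf01 a = 1 / (a 0 + cf01 (fun n => a (n + 1))) := by
  rw [cf01, cfVal_eq ha]

/-! ### Sequences with digits in `{1, 2, 3}` -/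

lemma cf01_mem_Icc {a : ℕ → ℕ} (ha : ∀ n, 1 ≤ a n ∧ a n ≤ 3) :
    cf01 a ∈ Set.Icc (1 / 4 : ℝ) (4 / 5) := by
  have key : ∀ b : ℕ → ℕ, (∀ n, 1 ≤ b n ∧ b n ≤ 3) → 1 / 4 ≤ cf01 b ∧ cf01 b ≤ 1 := by
    intro b hb
    have h1 : 1 ≤ cfVal b := one_le_cfVal fun n => (hb n).1
    have h2 : cfVal b ≤ 4 := by
      refine (le_of_tendsto' (tendsto_cfVal fun n => (hb n).1)
        fun n => (convergent_mem_Icc (fun n => (hb n).1) n).2).trans ?_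
      have : (b 0 : ℝ) ≤ 3 := by exact_mod_cast (hb 0).2
      linarith
    exact ⟨one_div_le_one_div_of_le (by linarith) h2, by
      unfold cf01; rw [div_le_one (by linarith)]; exact h1⟩
  refine ⟨(key a ha).1, ?_⟩
  rw [cf01_eq fun n => (ha n).1, div_le_div_iff₀ _ (by norm_num)]
  · have : (1 : ℝ) ≤ a 0 := by exact_mod_cast (ha 0).1
    linarith [(key (fun n => a (n + 1)) fun n => ha _).1]
  · have : (1 : ℝ) ≤ a 0 := by exact_mod_cast (ha 0).1
    linarith [(key (fun n => a (n + 1)) fun n => ha _).1]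

lemma one_div_add_mem_uIcc {a x y z : ℝ} (ha : 1 ≤ a) (hx : 0 ≤ x) (hy : 0 ≤ y)
    (hz : z ∈ Set.uIcc x y) : 1 / (a + z) ∈ Set.uIcc (1 / (a + x)) (1 / (a + y)) := by
  rcases Set.mem_uIcc.1 hz with h | h
  · exact Set.mem_uIcc.2 (Or.inr ⟨one_div_le_one_div_of_le (by linarith) (by linarith),
      one_div_le_one_div_of_le (by linarith) (by linarith)⟩)
  · exact Set.mem_uIcc.2 (Or.inl ⟨one_div_le_one_div_of_le (by linarith) (by linarith),
      one_div_le_one_div_of_le (by linarith) (by linarith)⟩)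

lemma cf01_mem_uIcc_of_agree {a b c : ℕ → ℕ} (ha : ∀ n, 1 ≤ a n) (hb : ∀ n, 1 ≤ b n)
    (hc : ∀ n, 1 ≤ c n) (n : ℕ) (hac : ∀ i < n, c i = a i) (hbc : ∀ i < n, c i = b i)
    (h : cf01 (fun i => c (i + n)) ∈
      Set.uIcc (cf01 fun i => a (i + n)) (cf01 fun i => b (i + n))) :
    cf01 c ∈ Set.uIcc (cf01 a) (cf01 b) := by
  induction n generalizing a b c with
  | zero => simpa using h
  | succ n ih =>
    have := ih (a := fun i => a (i + 1)) (b := fun i => b (i + 1)) (c := fun i => c (i + 1))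
      (fun i => ha _) (fun i => hb _) (fun i => hc _) (fun i hi => hac _ (by omega))
      (fun i hi => hbc _ (by omega)) (by simpa only [add_assoc, add_comm, add_left_comm] using h)
    rw [cf01_eq ha, cf01_eq hb, cf01_eq hc, ← hac 0 (by omega), ← hbc 0 (by omega)]
    exact one_div_add_mem_uIcc (by exact_mod_cast hc 0) (cf01_pos fun i => ha _).le
      (cf01_pos fun i => hb _).le this

lemma abs_cf01_sub_le {a b : ℕ → ℕ} (ha : ∀ n, 1 ≤ a n ∧ a n ≤ 3)
    (hb : ∀ n, 1 ≤ b n ∧ b n ≤ 3) (n : ℕ) (hab : ∀ i < n, a i = b i) :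
    |cf01 a - cf01 b| ≤ (16 / 25) ^ n := by
  induction n generalizing a b with
  | zero =>
    have h1 := cf01_mem_Icc ha
    have h2 := cf01_mem_Icc hb
    rw [pow_zero, abs_le]
    constructor <;> linarith [h1.1, h1.2, h2.1, h2.2]
  | succ n ih =>
    have ih' := ih (a := fun i => a (i + 1)) (b := fun i => b (i + 1)) (fun i => ha _)
      (fun i => hb _) (fun i hi => hab _ (by omega))
    rw [cf01_eq fun n => (ha n).1, cf01_eq fun n => (hb n).1, ← hab 0 (by omega)]
    have h1 := (cf01_mem_Icc (a := fun i => a (i + 1)) fun i => ha _).1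
    have h2 := (cf01_mem_Icc (a := fun i => b (i + 1)) fun i => hb _).1
    set x := cf01 fun i => a (i + 1)
    set y := cf01 fun i => b (i + 1)
    have h0 : (1 : ℝ) ≤ a 0 := by exact_mod_cast (ha 0).1
    have e : 1 / ((a 0 : ℝ) + x) - 1 / (a 0 + y) = (y - x) / ((a 0 + x) * (a 0 + y)) := by
      rw [div_sub_div _ _ (by linarith) (by linarith)]
      ring
    have h3 : (25 / 16 : ℝ) ≤ (a 0 + x) * (a 0 + y) := by nlinarith
    rw [e, abs_div, abs_sub_comm, abs_of_pos (by linarith : 0 < ((a 0 : ℝ) + x) * (a 0 + y)),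
      div_le_iff₀ (by linarith), pow_succ]
    have h4 : (0 : ℝ) ≤ (16 / 25) ^ n := by positivity
    nlinarith

/-- `[0; α k, α (k+1), …]`. -/
noncomputable def rightCF (α : ℤ → ℕ) (k : ℤ) : ℝ := cf01 fun n : ℕ => α (k + n)

/-- `[0; α k, α (k-1), …]`. -/
noncomputable def leftCF (α : ℤ → ℕ) (k : ℤ) : ℝ := cf01 fun n : ℕ => α (k - n)

/-- The value `λ₀(σᵏ α)`, written symmetrically in past and future. -/
noncomputable def lamAt (α : ℤ → ℕ) (k : ℤ) : ℝ :=
  α k + rightCF α (k + 1) + leftCF α (k - 1)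

lemma lambda0_shiftZ {α : ℤ → ℕ} (hα : ∀ i, 1 ≤ α i) (k : ℤ) :
    lambda0 (shiftZ k α) = lamAt α k := by
  unfold lambda0 lamAt rightCF leftCF shiftZ
  rw [cfVal_eq fun n => hα _]
  congr 1
  · congr 1
    · simp
    · congr 1; funext n; congr 1; push_cast; ring
  · congr 1; funext n; congr 1; ring

/-- All digits of `α` lie in `{1, 2, 3}`. -/
def DigitsLeThree (α : ℤ → ℕ) : Prop := ∀ i, 1 ≤ α i ∧ α i ≤ 3

/-- Sequences with digits in `{1, 2, 3}` and Markov value at most `t`. -/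
def markovSublevel (t : ℝ) : Set (ℤ → ℕ) :=
  {α | DigitsLeThree α ∧ ∀ k, lamAt α k ≤ t}

/-- Reversal of a bi-infinite sequence. -/
def reflect (α : ℤ → ℕ) : ℤ → ℕ := fun i => α (-i)

lemma rightCF_reflect (α : ℤ → ℕ) (k : ℤ) : rightCF (reflect α) k = leftCF α (-k) := by
  unfold rightCF leftCF reflect
  congr 1; funext n; congr 1; ring

lemma leftCF_reflect (α : ℤ → ℕ) (k : ℤ) : leftCF (reflect α) k = rightCF α (-k) := by
  unfold rightCF leftCF reflect
  congr 1; funext n; congr 1; ring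

lemma lamAt_reflect (α : ℤ → ℕ) (k : ℤ) : lamAt (reflect α) k = lamAt α (-k) := by
  unfold lamAt
  rw [rightCF_reflect, leftCF_reflect, add_right_comm, reflect]
  ring_nf

lemma DigitsLeThree.reflect {α : ℤ → ℕ} (h : DigitsLeThree α) : DigitsLeThree (reflect α) :=
  fun i => h (-i)

lemma reflect_mem_markovSublevel {α : ℤ → ℕ} {t : ℝ} (h : α ∈ markovSublevel t) :
    reflect α ∈ markovSublevel t :=
  ⟨h.1.reflect, fun k => by rw [lamAt_reflect]; exact h.2 _⟩

lemma rightCF_eq {α : ℤ → ℕ} (h : DigitsLeThree α) (k : ℤ) :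
    rightCF α k = 1 / (α k + rightCF α (k + 1)) := by
  unfold rightCF
  rw [cf01_eq fun n => (h _).1]
  congr 2
  · simp
  · congr 1; funext n; congr 1; push_cast; ring

lemma leftCF_eq {α : ℤ → ℕ} (h : DigitsLeThree α) (k : ℤ) :
    leftCF α k = 1 / (α k + leftCF α (k - 1)) := by
  have := rightCF_eq h.reflect (-k)
  simp only [rightCF_reflect, reflect, neg_neg] at this
  rw [this]
  congr 3
  ring

lemma rightCF_mem_Icc {α : ℤ → ℕ} (h : DigitsLeThree α) (k : ℤ) :
    rightCF α k ∈ Set.Icc (1 / 4 : ℝ) (4 / 5) := cf01_mem_Icc fun _ => h _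

lemma leftCF_mem_Icc {α : ℤ → ℕ} (h : DigitsLeThree α) (k : ℤ) :
    leftCF α k ∈ Set.Icc (1 / 4 : ℝ) (4 / 5) := cf01_mem_Icc fun _ => h _

lemma rightCF_bounds {α : ℤ → ℕ} (h : DigitsLeThree α) (k : ℤ) :
    5 / 19 ≤ rightCF α k ∧ rightCF α k ≤ 19 / 24 := by
  have low : ∀ k, 5 / 19 ≤ rightCF α k := fun k => by
    have h3 : (α k : ℝ) ≤ 3 := by exact_mod_cast (h k).2
    have := rightCF_mem_Icc h (k + 1)
    rw [rightCF_eq h, div_le_div_iff₀ (by norm_num) (by linarith [this.1, (α k).cast_nonneg (α := ℝ)])]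
    linarith [this.2]
  refine ⟨low k, ?_⟩
  have h1 : (1 : ℝ) ≤ α k := by exact_mod_cast (h k).1
  have := low (k + 1)
  rw [rightCF_eq h, div_le_div_iff₀ (by linarith) (by norm_num)]
  linarith

lemma leftCF_bounds {α : ℤ → ℕ} (h : DigitsLeThree α) (k : ℤ) :
    5 / 19 ≤ leftCF α k ∧ leftCF α k ≤ 19 / 24 := by
  have := rightCF_bounds h.reflect (-k)
  rwa [rightCF_reflect, neg_neg] at this

/-- Cleared form of the recursion for `rightCF`, convenient for linear arithmetic. -/
lemma rightCF_mul {α : ℤ → ℕ} (h : DigitsLeThree α) (k : ℤ) :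
    rightCF α k * (α k + rightCF α (k + 1)) = 1 := by
  rw [rightCF_eq h k]
  apply one_div_mul_cancel
  have := (rightCF_bounds h (k + 1)).1
  positivity

lemma leftCF_mul {α : ℤ → ℕ} (h : DigitsLeThree α) (k : ℤ) :
    leftCF α k * (α k + leftCF α (k - 1)) = 1 := by
  rw [leftCF_eq h k]
  apply one_div_mul_cancel
  have := (leftCF_bounds h (k - 1)).1
  positivity

lemma one_div_le_of_mul_eq_one {x y u : ℝ} (h : x * y = 1) (hy : 0 < y) (hyu : y ≤ u) :
    1 / u ≤ x := by
  rw [eq_one_div_of_mul_eq_one_left h]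
  exact one_div_le_one_div_of_le hy hyu

lemma le_one_div_of_mul_eq_one {x y u : ℝ} (h : x * y = 1) (hu : 0 < u) (huy : u ≤ y) :
    x ≤ 1 / u := by
  rw [eq_one_div_of_mul_eq_one_left h]
  exact one_div_le_one_div_of_le hu huy

/-! ### Markov value below `3.84` forbids the words `13` and `31` -/

section Forbidden

variable {α : ℤ → ℕ} {t : ℝ}

lemma prev_eq_three_of_three_one (hα : α ∈ markovSublevel t) (ht : t < 3.84) {k : ℤ}
    (h3 : α k = 3) (h1 : α (k + 1) = 1) : α (k - 1) = 3 := by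
  obtain ⟨hd, hl⟩ := hα
  by_contra hne
  have h2 : (α (k - 1) : ℝ) ≤ 2 := by
    have := (hd (k - 1)).2
    exact_mod_cast (by omega : α (k - 1) ≤ 2)
  have hk := hl k
  have hR := rightCF_mul hd (k + 1)
  have hL := leftCF_mul hd (k - 1)
  have b1 := rightCF_bounds hd (k + 1 + 1)
  have b2 := leftCF_bounds hd (k - 1 - 1)
  have b3 := rightCF_bounds hd (k + 1)
  have b4 := leftCF_bounds hd (k - 1)
  rw [lamAt, h3] at hk
  rw [h1] at hR
  push_cast at hk hR
  norm_num at ht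
  have : 24 / 43 ≤ rightCF α (k + 1) := by nlinarith
  have : 24 / 67 ≤ leftCF α (k - 1) := by nlinarith
  linarith

lemma next_eq_three_of_one_three (hα : α ∈ markovSublevel t) (ht : t < 3.84) {k : ℤ}
    (h3 : α k = 3) (h1 : α (k - 1) = 1) : α (k + 1) = 3 := by
  have := prev_eq_three_of_three_one (reflect_mem_markovSublevel hα) ht (k := -k)
    (by simpa [reflect] using h3) (by rw [reflect, ← h1]; ring_nf)
  rw [← this, reflect]
  ring_nf

lemma one_neighbours_of_three_one (hα : α ∈ markovSublevel t) (ht : t < 3.84) {k : ℤ}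
    (h3 : α k = 3) (h1 : α (k + 1) = 1) : α (k + 1 + 1) = 1 ∧ α (k - 1 - 1) = 1 := by
  have hp := prev_eq_three_of_three_one hα ht h3 h1
  obtain ⟨hd, hl⟩ := hα
  have hk := hl k
  have hR := rightCF_mul hd (k + 1)
  have hL := leftCF_mul hd (k - 1)
  have hR' := rightCF_mul hd (k + 1 + 1)
  have hL' := leftCF_mul hd (k - 1 - 1)
  have b1 := rightCF_bounds hd (k + 1 + 1)
  have b2 := leftCF_bounds hd (k - 1 - 1)
  have b3 := rightCF_bounds hd (k + 1)
  have b4 := leftCF_bounds hd (k - 1)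
  have b5 := rightCF_bounds hd (k + 1 + 1 + 1)
  have b6 := leftCF_bounds hd (k - 1 - 1 - 1)
  rw [lamAt, h3] at hk
  rw [h1] at hR
  rw [hp] at hL
  push_cast at hk hR hL
  norm_num at ht
  constructor
  · by_contra hne
    have h2 : (2 : ℝ) ≤ α (k + 1 + 1) := by
      have := (hd (k + 1 + 1)).1
      exact_mod_cast (by omega : 2 ≤ α (k + 1 + 1))
    have c1 : rightCF α (k + 1 + 1) ≤ 1 / 2 := by nlinarith
    have c2 : 2 / 3 ≤ rightCF α (k + 1) := by nlinarith
    linarith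
  · by_contra hne
    have h2 : (2 : ℝ) ≤ α (k - 1 - 1) := by
      have := (hd (k - 1 - 1)).1
      exact_mod_cast (by omega : 2 ≤ α (k - 1 - 1))
    have c1 : leftCF α (k - 1 - 1) ≤ 1 / 2 := by nlinarith
    have c2 : 2 / 7 ≤ leftCF α (k - 1) := by nlinarith
    have c3 : 24 / 43 ≤ rightCF α (k + 1) := by nlinarith
    linarith

lemma one_neighbours_of_one_three (hα : α ∈ markovSublevel t) (ht : t < 3.84) {k : ℤ}
    (h3 : α k = 3) (h1 : α (k - 1) = 1) : α (k - 1 - 1) = 1 ∧ α (k + 1 + 1) = 1 := by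
  have := one_neighbours_of_three_one (reflect_mem_markovSublevel hα) ht (k := -k)
    (by simpa [reflect] using h3) (by rw [reflect, ← h1]; ring_nf)
  simp only [reflect] at this
  ring_nf at this ⊢
  exact this

lemma not_three_one (hα : α ∈ markovSublevel t) (ht : t < 3.84) (k : ℤ) :
    ¬ (α k = 3 ∧ α (k + 1) = 1) := by
  rintro ⟨h3, h1⟩
  have hm1 := prev_eq_three_of_three_one hα ht h3 h1
  obtain ⟨h2, hm2⟩ := one_neighbours_of_three_one hα ht h3 h1
  have hm3 := (one_neighbours_of_one_three hα ht hm1 hm2).1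
  have hd := hα.1
  have hk := hα.2 k
  have hR1 := rightCF_mul hd (k + 1)
  have hR2 := rightCF_mul hd (k + 1 + 1)
  have hL1 := leftCF_mul hd (k - 1)
  have hL2 := leftCF_mul hd (k - 1 - 1)
  have hL3 := leftCF_mul hd (k - 1 - 1 - 1)
  have hR3 := rightCF_mul hd (k + 1 + 1 + 1)
  have hR4 := rightCF_mul hd (k + 1 + 1 + 1 + 1)
  have hR5 := rightCF_mul hd (k + 1 + 1 + 1 + 1 + 1)
  have b1 := rightCF_bounds hd (k + 1)
  have b2 := rightCF_bounds hd (k + 1 + 1)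
  have b3 := rightCF_bounds hd (k + 1 + 1 + 1)
  have b4 := rightCF_bounds hd (k + 1 + 1 + 1 + 1)
  have b5 := rightCF_bounds hd (k + 1 + 1 + 1 + 1 + 1)
  have b6 := rightCF_bounds hd (k + 1 + 1 + 1 + 1 + 1 + 1)
  have d1 := leftCF_bounds hd (k - 1)
  have d2 := leftCF_bounds hd (k - 1 - 1)
  have d3 := leftCF_bounds hd (k - 1 - 1 - 1)
  have d4 := leftCF_bounds hd (k - 1 - 1 - 1 - 1)
  rw [lamAt, h3] at hk
  rw [h1] at hR1
  rw [h2] at hR2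
  rw [hm1] at hL1
  rw [hm2] at hL2
  rw [hm3] at hL3
  push_cast at hk hR1 hR2 hL1 hL2 hL3
  have ht' : t < 96 / 25 := by norm_num at ht; exact ht
  have e3 := one_div_le_of_mul_eq_one hL3 (u := 43 / 24) (by linarith) (by linarith)
  have e2 := le_one_div_of_mul_eq_one hL2 (u := 67 / 43) (by norm_num) (by linarith)
  have e1 := one_div_le_of_mul_eq_one hL1 (u := 244 / 67) (by linarith) (by linarith)
  have f2 := one_div_le_of_mul_eq_one ((mul_comm _ _).trans hR1) (u := 56542 / 100000)
    (by linarith) (by linarith)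
  have f3 := le_one_div_of_mul_eq_one ((mul_comm _ _).trans hR2) (u := 7685 / 10000)
    (by norm_num) (by linarith)
  have hp3 : α (k + 1 + 1 + 1) = 3 := by
    by_contra hne
    have : (α (k + 1 + 1 + 1) : ℝ) ≤ 2 := by
      have := (hd (k + 1 + 1 + 1)).2
      exact_mod_cast (by omega : α (k + 1 + 1 + 1) ≤ 2)
    have hn : (0 : ℝ) ≤ α (k + 1 + 1 + 1) := Nat.cast_nonneg _
    have := one_div_le_of_mul_eq_one hR3 (u := 67 / 24) (by linarith) (by linarith)
    linarith
  have h2' : α (k + 1 + 1 + 1 - 1) = 1 := by rw [← h2]; ring_nf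
  have hp4 := next_eq_three_of_one_three hα ht hp3 h2'
  have hp5 := (one_neighbours_of_one_three hα ht hp3 h2').2
  rw [hp3] at hR3
  rw [hp4] at hR4
  rw [hp5] at hR5
  push_cast at hR3 hR4 hR5
  have g5 := one_div_le_of_mul_eq_one hR5 (u := 43 / 24) (by linarith) (by linarith)
  have g4 := le_one_div_of_mul_eq_one hR4 (u := 153 / 43) (by norm_num) (by linarith)
  have g3 := one_div_le_of_mul_eq_one hR3 (u := 502 / 153) (by linarith) (by linarith)
  linarith

lemma not_one_three (hα : α ∈ markovSublevel t) (ht : t < 3.84) (k : ℤ) :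
    ¬ (α k = 1 ∧ α (k + 1) = 3) := by
  rintro ⟨h1, h3⟩
  refine not_three_one (reflect_mem_markovSublevel hα) ht (-(k + 1)) ⟨?_, ?_⟩
  · simpa [reflect] using h3
  · rw [reflect, ← h1]; ring_nf

end Forbidden

/-! ### The largest continued fraction avoiding the word `13` -/

/-- The sequence `1, 2, 1, 2, …`. -/
def altSeq (n : ℕ) : ℕ := if Even n then 1 else 2

lemma altSeq_mem (n : ℕ) : 1 ≤ altSeq n ∧ altSeq n ≤ 2 := by
  unfold altSeq; split <;> simp

lemma cf01_altSeq : cf01 altSeq = 1 / (1 + 1 / (2 + cf01 altSeq)) := by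
  have h2 : (fun n => altSeq (n + 1 + 1)) = altSeq := by
    funext n; simp [altSeq, Nat.even_add_one]
  conv_lhs => rw [cf01_eq fun n => (altSeq_mem n).1,
    cf01_eq (a := fun n => altSeq (n + 1)) fun n => (altSeq_mem _).1]
  rw [h2]
  simp [altSeq]

lemma cf01_le_cf01_altSeq {a : ℕ → ℕ} (ha : ∀ n, 1 ≤ a n ∧ a n ≤ 3)
    (h13 : ∀ n, ¬ (a n = 1 ∧ a (n + 1) = 3)) : cf01 a ≤ cf01 altSeq := by
  set M := cf01 altSeq with hM
  have hMeq : M = 1 / (1 + 1 / (2 + M)) := cf01_altSeq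
  have hM0 : 1 / 4 ≤ M := (cf01_mem_Icc fun n => ⟨(altSeq_mem n).1,
    (altSeq_mem n).2.trans (by norm_num)⟩).1
  have hM2 : 1 / 2 ≤ M := by
    rw [hMeq, div_le_div_iff₀ (by norm_num) (by positivity), one_mul, one_mul]
    have : 1 / (2 + M) ≤ 1 := by rw [div_le_one (by linarith)]; linarith
    linarith
  have key : ∀ n : ℕ, ∀ a : ℕ → ℕ, (∀ n, 1 ≤ a n ∧ a n ≤ 3) →
      (∀ n, ¬ (a n = 1 ∧ a (n + 1) = 3)) → cf01 a ≤ M + (1 / 4) ^ n := by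
    intro n
    induction n with
    | zero => intro a ha _; rw [pow_zero]; linarith [(cf01_mem_Icc ha).2]
    | succ n ih =>
      intro a ha h13
      have hp : (0 : ℝ) < (1 / 4) ^ n := by positivity
      have h1 := (cf01_mem_Icc (a := fun i => a (i + 1)) fun i => ha _).1
      by_cases h0 : a 0 = 1
      · have hx := ih (fun i => a (i + 1 + 1)) (fun i => ha _) fun i => h13 _
        have hx0 := (cf01_mem_Icc (a := fun i => a (i + 1 + 1)) fun i => ha _).1
        have ha1 : (a (0 + 1) : ℝ) ≤ 2 := by
          have h3 := h13 0
          have h4 := (ha (0 + 1)).2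
          have : a (0 + 1) ≤ 2 := by
            by_contra hcon
            exact h3 ⟨h0, by omega⟩
          exact_mod_cast this
        have ha1' : (1 : ℝ) ≤ a (0 + 1) := by exact_mod_cast (ha _).1
        rw [cf01_eq fun n => (ha n).1, cf01_eq (a := fun i => a (i + 1)) fun n => (ha _).1, h0]
        set x := cf01 fun i => a (i + 1 + 1)
        set p : ℝ := (1 / 4) ^ n
        have e1 : 1 / (2 + (M + p)) ≤ 1 / (a (0 + 1) + x) :=
          one_div_le_one_div_of_le (by linarith) (by linarith)
        have e2 : 1 / (((1 : ℕ) : ℝ) + 1 / (a (0 + 1) + x)) ≤ 1 / (1 + 1 / (2 + (M + p))) := by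
          push_cast
          exact one_div_le_one_div_of_le (by positivity) (by linarith)
        refine e2.trans ?_
        have e3 : 1 / (1 + 1 / (2 + (M + p))) - 1 / (1 + 1 / (2 + M)) =
            p / ((3 + M + p) * (3 + M)) := by
          field_simp
          ring
        have e4 : p / ((3 + M + p) * (3 + M)) ≤ p / 4 := by
          apply div_le_div_of_nonneg_left hp.le (by norm_num)
          nlinarith
        rw [← hMeq] at e3
        rw [pow_succ]
        linarith
      · have : (2 : ℝ) ≤ a 0 := by
          have := (ha 0).1
          exact_mod_cast (by omega : 2 ≤ a 0)
        have h2 : cf01 a ≤ 1 / 2 := by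
          rw [cf01_eq fun n => (ha n).1]
          exact one_div_le_one_div_of_le (by norm_num) (by linarith)
        have : (0 : ℝ) < (1 / 4) ^ (n + 1) := by positivity
        linarith
  refine le_of_forall_pos_le_add fun ε hε => ?_
  obtain ⟨n, hn⟩ := exists_pow_lt_of_lt_one hε (by norm_num : (1 / 4 : ℝ) < 1)
  linarith [key n a ha h13]

/-! ### Connecting to sequences in `{1, 2}` -/

lemma abs_rightCF_sub_le {α β : ℤ → ℕ} (hα : DigitsLeThree α) (hβ : DigitsLeThree β) (k : ℤ)
    (n : ℕ) (h : ∀ i, k ≤ i → i < k + n → α i = β i) :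
    |rightCF α k - rightCF β k| ≤ (16 / 25) ^ n :=
  abs_cf01_sub_le (fun _ => hα _) (fun _ => hβ _) n fun i hi => h _ (by omega) (by omega)

lemma abs_leftCF_sub_le {α β : ℤ → ℕ} (hα : DigitsLeThree α) (hβ : DigitsLeThree β) (k : ℤ)
    (n : ℕ) (h : ∀ i, k - n < i → i ≤ k → α i = β i) :
    |leftCF α k - leftCF β k| ≤ (16 / 25) ^ n :=
  abs_cf01_sub_le (fun _ => hα _) (fun _ => hβ _) n fun i hi => h _ (by omega) (by omega)

lemma abs_lamAt_sub_le {α β : ℤ → ℕ} (hα : DigitsLeThree α) (hβ : DigitsLeThree β) (k : ℤ)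
    (n : ℕ) (h : ∀ i, k - n ≤ i → i ≤ k + n → α i = β i) :
    |lamAt α k - lamAt β k| ≤ 2 * (16 / 25) ^ n := by
  have h1 := abs_rightCF_sub_le hα hβ (k + 1) n fun i h1 h2 => h i (by omega) (by omega)
  have h2 := abs_leftCF_sub_le hα hβ (k - 1) n fun i h1 h2 => h i (by omega) (by omega)
  rw [abs_le] at *
  unfold lamAt
  rw [h k (by omega) (by omega)]
  constructor <;> linarith [h1.1, h1.2, h2.1, h2.2]

lemma lamAt_le_of_digit_le_two {α : ℤ → ℕ} (hα : DigitsLeThree α) {k : ℤ} (hk : α k ≤ 2) :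
    lamAt α k ≤ 18 / 5 := by
  have h : (α k : ℝ) ≤ 2 := by exact_mod_cast hk
  unfold lamAt
  linarith [(rightCF_mem_Icc hα (k + 1)).2, (leftCF_mem_Icc hα (k - 1)).2]

lemma rightCF_le_cf01_altSeq {α : ℤ → ℕ} {t : ℝ} (hα : α ∈ markovSublevel t) (ht : t < 3.84)
    (k : ℤ) : rightCF α k ≤ cf01 altSeq := by
  refine cf01_le_cf01_altSeq (fun _ => hα.1 _) fun n => ?_
  have := not_one_three hα ht (k + n)
  push_cast
  rwa [add_assoc] at this

/-- `g` is a sequence extending the central window of `β` of radius `W`, such that every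
sequence following `g` from `-W` up to some `L ≥ N` has values nearly at most `max t 3.6` up to
`L`. -/
def RightConnects (t : ℝ) (W : ℕ) (β g : ℤ → ℕ) (N : ℕ) : Prop :=
  DigitsLeThree g ∧ (∀ i : ℤ, -W ≤ i → i ≤ W → g i = β i) ∧
    ∀ L : ℕ, N ≤ L → ∀ η, DigitsLeThree η → (∀ i : ℤ, -W ≤ i → i ≤ L → η i = g i) →
      ∀ k : ℤ, 0 ≤ k → k ≤ L → lamAt η k ≤ max (t + 3 * (16 / 25) ^ W) (18 / 5)

lemma exists_rightConnects_of_lt {t : ℝ} (ht : t < 3.84) {β β' : ℤ → ℕ}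
    (hβ : β ∈ markovSublevel t) (hβ' : β' ∈ markovSublevel t) {W : ℕ} {p : ℤ} (hp : W < p)
    (hag : ∀ i : ℤ, -W ≤ i → i < p → β i = β' i) (hlt : β p < β' p) :
    ∃ g N, RightConnects t W β g N := by
  set g : ℤ → ℕ := fun i => if i ≤ p then β i else altSeq (i - p - 1).toNat with hg
  have hgd : DigitsLeThree g := fun i => by
    by_cases h : i ≤ p
    · simpa [hg, h] using hβ.1 i
    · simp only [hg, h, if_false]
      have := altSeq_mem (i - p - 1).toNat
      omega
  have hgβ : ∀ i ≤ p, g i = β i := fun i hi => by simp [hg, hi]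
  have hg2 : ∀ i, p ≤ i → g i ≤ 2 := fun i hi => by
    rcases eq_or_lt_of_le hi with rfl | h
    · rw [hgβ _ le_rfl]
      have := (hβ'.1 p).2
      omega
    · simp only [hg, not_le.2 h, if_false]
      exact (altSeq_mem _).2
  have hgtail : rightCF g (p + 1) = cf01 altSeq := by
    unfold rightCF
    congr 1
    funext n
    have h1 : ¬ (p + 1 + (n : ℤ) ≤ p) := by omega
    have h2 : (p + 1 + (n : ℤ) - p - 1).toNat = n := by omega
    simp only [hg, h1, if_false, h2]
  have hbetween : rightCF g p ∈ Set.uIcc (rightCF β p) (rightCF β' p) := by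
    have hM := cf01_mem_Icc (a := altSeq) fun n => ⟨(altSeq_mem n).1,
      (altSeq_mem n).2.trans (by norm_num)⟩
    have hb : (1 : ℝ) ≤ β p := by exact_mod_cast (hβ.1 p).1
    have hb' : (β p : ℝ) + 1 ≤ β' p := by exact_mod_cast hlt
    rw [rightCF_eq hgd p, hgtail, rightCF_eq hβ.1 p, rightCF_eq hβ'.1 p, hgβ p le_rfl]
    have h1 := rightCF_le_cf01_altSeq hβ ht (p + 1)
    have h2 := (rightCF_mem_Icc hβ.1 (p + 1)).1
    have h3 := (rightCF_mem_Icc hβ'.1 (p + 1)).1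
    exact Set.mem_uIcc.2 (Or.inr ⟨one_div_le_one_div_of_le (by linarith [hM.1])
      (by linarith [hM.2]), one_div_le_one_div_of_le (by linarith) (by linarith)⟩)
  have hglam : ∀ k : ℤ, 0 ≤ k → k < p → lamAt g k ≤ t + (16 / 25) ^ W := by
    intro k hk0 hkp
    have hmem : rightCF g (k + 1) ∈ Set.uIcc (rightCF β (k + 1)) (rightCF β' (k + 1)) := by
      refine cf01_mem_uIcc_of_agree (fun n => (hβ.1 _).1) (fun n => (hβ'.1 _).1)
        (fun n => (hgd _).1) (p - (k + 1)).toNat (fun i hi => hgβ _ (by omega))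
        (fun i hi => (hgβ _ (by omega)).trans (hag _ (by omega) (by omega))) ?_
      have e : ∀ i : ℕ, k + 1 + ((i + (p - (k + 1)).toNat : ℕ) : ℤ) = p + i := fun i => by
        omega
      simp only [e]
      exact hbetween
    have hleft : leftCF g (k - 1) = leftCF β (k - 1) := by
      unfold leftCF
      congr 1
      funext n
      exact hgβ _ (by omega)
    have hleft' := abs_leftCF_sub_le hβ.1 hβ'.1 (k - 1) W fun i h1 h2 =>
      hag i (by omega) (by omega)
    rw [abs_le] at hleft'
    have hβk := hβ.2 k
    have hβk' := hβ'.2 k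
    have hpow : (0 : ℝ) < (16 / 25) ^ W := by positivity
    unfold lamAt at *
    rw [← hag k (by omega) hkp] at hβk'
    rw [hgβ k hkp.le, hleft]
    rcases Set.mem_uIcc.1 hmem with h | h <;> linarith [h.1, h.2, hleft'.1, hleft'.2]
  refine ⟨g, (p + W).toNat, hgd, fun i _ hi => hgβ i (by omega),
    fun L hL η hη hηg k hk0 hkL => ?_⟩
  rcases lt_or_ge k p with hkp | hkp
  · refine le_max_of_le_left ?_
    have := abs_lamAt_sub_le hη hgd k W fun i h1 h2 => hηg i (by omega) (by omega)
    rw [abs_le] at this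
    linarith [this.2, hglam k hk0 hkp]
  · refine le_max_of_le_right (lamAt_le_of_digit_le_two hη ?_)
    rw [hηg k (by omega) hkL]
    exact hg2 k hkp

lemma RightConnects.congr {t : ℝ} {W : ℕ} {β β' g : ℤ → ℕ} {N : ℕ}
    (h : RightConnects t W β g N) (hb : ∀ i : ℤ, -W ≤ i → i ≤ W → β i = β' i) :
    RightConnects t W β' g N :=
  ⟨h.1, fun i h1 h2 => (h.2.1 i h1 h2).trans (hb i h1 h2), h.2.2⟩

lemma exists_rightConnects {t : ℝ} (ht : t < 3.84) {β β' : ℤ → ℕ}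
    (hβ : β ∈ markovSublevel t) (hβ' : β' ∈ markovSublevel t) {W : ℕ}
    (hag : ∀ i : ℤ, -W ≤ i → i ≤ W → β i = β' i) (hne : ∃ i : ℤ, W < i ∧ β i ≠ β' i) :
    ∃ g N, RightConnects t W β g N := by
  classical
  have hex : ∃ n : ℕ, β (W + 1 + n) ≠ β' (W + 1 + n) := by
    obtain ⟨i, hi, hi'⟩ := hne
    refine ⟨(i - W - 1).toNat, ?_⟩
    rwa [show (W : ℤ) + 1 + ((i - W - 1).toNat : ℕ) = i by omega]
  have hfirst := Nat.find_spec hex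
  have hmin : ∀ i : ℤ, -W ≤ i → i < W + 1 + (Nat.find hex : ℕ) → β i = β' i := by
    intro i h1 h2
    by_cases h3 : i ≤ W
    · exact hag i h1 h3
    · have := Nat.find_min hex (m := (i - W - 1).toNat) (by omega)
      rw [not_not] at this
      rwa [show (W : ℤ) + 1 + ((i - W - 1).toNat : ℕ) = i by omega] at this
  rcases lt_or_gt_of_ne hfirst with h | h
  · exact exists_rightConnects_of_lt ht hβ hβ' (by omega) hmin h
  · obtain ⟨g, N, hgN⟩ := exists_rightConnects_of_lt ht hβ' hβ (W := W) (by omega)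
      (fun i h1 h2 => (hmin i h1 h2).symm) h
    exact ⟨g, N, hgN.congr fun i h1 h2 => (hag i h1 h2).symm⟩

/-- `η` extends the central window of `α` of radius `W`, such that every
sequence following `η` on `[-L, L]`, `L ≥ N`, has values nearly at most `max t 3.6` there. -/
def Connects (t : ℝ) (W : ℕ) (α η : ℤ → ℕ) (N : ℕ) : Prop :=
  DigitsLeThree η ∧ (∀ i : ℤ, -W ≤ i → i ≤ W → η i = α i) ∧
    ∀ L : ℕ, N ≤ L → ∀ ζ, DigitsLeThree ζ → (∀ i : ℤ, -L ≤ i → i ≤ L → ζ i = η i) →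
      ∀ k : ℤ, -L ≤ k → k ≤ L → lamAt ζ k ≤ max (t + 3 * (16 / 25) ^ W) (18 / 5)

lemma exists_connects {t : ℝ} (ht : t < 3.84) {α β β' γ γ' : ℤ → ℕ} {W : ℕ}
    (hβ : β ∈ markovSublevel t) (hβ' : β' ∈ markovSublevel t)
    (hγ : γ ∈ markovSublevel t) (hγ' : γ' ∈ markovSublevel t)
    (hβα : ∀ i : ℤ, -W ≤ i → i ≤ W → β i = α i) (hβα' : ∀ i : ℤ, -W ≤ i → i ≤ W → β' i = α i)
    (hγα : ∀ i : ℤ, -W ≤ i → i ≤ W → γ i = α i) (hγα' : ∀ i : ℤ, -W ≤ i → i ≤ W → γ' i = α i)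
    (hne : ∃ i : ℤ, W < i ∧ β i ≠ β' i) (hne' : ∃ i : ℤ, i < -W ∧ γ i ≠ γ' i) :
    ∃ η N, Connects t W α η N := by
  obtain ⟨g, N, hg⟩ := exists_rightConnects ht hβ hβ'
    (fun i h1 h2 => (hβα i h1 h2).trans (hβα' i h1 h2).symm) hne
  obtain ⟨f, N', hf⟩ := exists_rightConnects ht (reflect_mem_markovSublevel hγ)
    (reflect_mem_markovSublevel hγ') (W := W)
    (fun i h1 h2 => (hγα (-i) (by omega) (by omega)).trans
      (hγα' (-i) (by omega) (by omega)).symm) (by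
      obtain ⟨i, hi, hi'⟩ := hne'
      exact ⟨-i, by omega, by simpa [reflect] using hi'⟩)
  obtain ⟨hgd, hgβ, hgL⟩ := hg
  obtain ⟨hfd, hfγ, hfL⟩ := hf
  have hgα : ∀ i : ℤ, -W ≤ i → i ≤ W → g i = α i := fun i h1 h2 =>
    (hgβ i h1 h2).trans (hβα i h1 h2)
  have hfα : ∀ i : ℤ, -W ≤ i → i ≤ W → f i = α (-i) := fun i h1 h2 =>
    (hfγ i h1 h2).trans (hγα (-i) (by omega) (by omega))
  set η : ℤ → ℕ := fun i => if -W ≤ i then g i else f (-i) with hη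
  have hηg : ∀ i : ℤ, -W ≤ i → η i = g i := fun i hi => by simp [hη, hi]
  have hηf : ∀ i : ℤ, i ≤ W → η i = f (-i) := fun i hi => by
    by_cases h : -(W : ℤ) ≤ i
    · rw [hηg i h, hgα i h hi, hfα (-i) (by omega) (by omega), neg_neg]
    · simp [hη, h]
  refine ⟨η, max W (max N N'), fun i => ?_, fun i h1 h2 => (hηg i h1).trans (hgα i h1 h2), ?_⟩
  · by_cases h : -(W : ℤ) ≤ i
    · rw [hηg i h]; exact hgd i
    · rw [hηf i (by omega)]; exact hfd _
  · intro L hL ζ hζ hζη k hk1 hk2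
    have hNL : N ≤ L := by omega
    have hNL' : N' ≤ L := by omega
    rcases le_total 0 k with hk | hk
    · exact hgL L hNL ζ hζ
        (fun i h1 h2 => (hζη i (by omega) h2).trans (hηg i h1)) k hk hk2
    · have := hfL L hNL' (reflect ζ) hζ.reflect (fun i h1 h2 => by
        rw [reflect, hζη (-i) (by omega) (by omega), hηf (-i) (by omega), neg_neg]) (-k)
        (by omega) (by omega)
      rwa [lamAt_reflect, neg_neg] at this

/-! ### Realizing connectable values in the Lagrange spectrum -/

lemma lamAt_comp_add (ζ : ℤ → ℕ) (c k : ℤ) : lamAt (fun i => ζ (i + c)) k = lamAt ζ (k + c) := by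
  unfold lamAt rightCF leftCF
  have h1 : ∀ n : ℕ, k + 1 + n + c = k + c + 1 + n := fun n => by ring
  have h2 : ∀ n : ℕ, k - 1 - n + c = k + c - 1 - n := fun n => by ring
  simp only [h1, h2]

lemma lamAt_mem_Icc {α : ℤ → ℕ} (h : DigitsLeThree α) (k : ℤ) : lamAt α k ∈ Set.Icc (0 : ℝ) 5 := by
  have h1 := rightCF_mem_Icc h (k + 1)
  have h2 := leftCF_mem_Icc h (k - 1)
  have h3 : (α k : ℝ) ≤ 3 := by exact_mod_cast (h k).2
  have h4 : (0 : ℝ) ≤ α k := Nat.cast_nonneg _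
  unfold lamAt
  constructor <;> linarith [h1.1, h1.2, h2.1, h2.2]

/-- The sequence whose block on `[j², j² + 2j]` is the central window of radius `j` of `η j`. -/
def blockSeq (η : ℕ → ℤ → ℕ) (i : ℤ) : ℕ :=
  if i < 0 then 1 else
    η (Nat.sqrt i.toNat) (i - ((Nat.sqrt i.toNat * Nat.sqrt i.toNat + Nat.sqrt i.toNat : ℕ) : ℤ))

lemma blockSeq_add (η : ℕ → ℤ → ℕ) (j : ℕ) (x : ℤ) (h1 : -(j : ℤ) ≤ x) (h2 : x ≤ j) :
    blockSeq η (x + ((j * j + j : ℕ) : ℤ)) = η j x := by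
  obtain ⟨y, hy⟩ : ∃ y : ℕ, (y : ℤ) = x + j := ⟨(x + j).toNat, by omega⟩
  have e : x + ((j * j + j : ℕ) : ℤ) = ((j * j + y : ℕ) : ℤ) := by push_cast; rw [hy]; ring
  have hs : Nat.sqrt (j * j + y) = j := Nat.sqrt_add_eq j (by omega)
  unfold blockSeq
  rw [e, Int.toNat_natCast, hs, if_neg (by omega)]
  congr 1
  push_cast at e ⊢
  linarith

lemma DigitsLeThree.blockSeq {η : ℕ → ℤ → ℕ} (h : ∀ j, DigitsLeThree (η j)) :
    DigitsLeThree (blockSeq η) := fun i => by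
  unfold _root_.blockSeq
  split
  · simp
  · exact h _ _

lemma mem_LagrangeSpectrum_of_connects {m : ℝ} (hm : 18 / 5 < m) {α : ℤ → ℕ}
    (hα : DigitsLeThree α) (hαm : lamAt α 0 = m) {ε : ℕ → ℝ} (hε : Tendsto ε atTop (nhds 0))
    {η : ℕ → ℤ → ℕ} {N : ℕ → ℕ} (hη : ∀ W, Connects (m + ε W) W α (η W) (N W)) :
    m ∈ LagrangeSpectrum := by
  classical
  set g : ℕ → ℕ := fun j => Nat.findGreatest (fun W => N W ≤ j) j with hg
  have hgtop : Tendsto g atTop atTop := tendsto_atTop.2 fun W =>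
    eventually_atTop.2 ⟨max W (N W), fun j hj =>
      Nat.le_findGreatest (le_trans (le_max_left _ _) hj) (le_trans (le_max_right _ _) hj)⟩
  have hNg : ∀ j, N 0 ≤ j → N (g j) ≤ j := fun j hj =>
    Nat.findGreatest_spec (P := fun W => N W ≤ j) (Nat.zero_le j) hj
  set ζ := blockSeq fun j => η (g j) with hζdef
  have hζ : DigitsLeThree ζ := DigitsLeThree.blockSeq fun j => (hη _).1
  set c : ℕ → ℤ := fun j => ((j * j + j : ℕ) : ℤ) with hc
  have hζc : ∀ (j : ℕ) (x : ℤ), -(j : ℤ) ≤ x → x ≤ j → ζ (x + c j) = η (g j) x :=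
    fun j x h1 h2 => blockSeq_add _ j x h1 h2
  have hshift : ∀ j, DigitsLeThree fun i => ζ (i + c j) := fun j i => hζ _
  have hupper : ∀ j, N 0 ≤ j → ∀ k : ℤ, -(j : ℤ) ≤ k → k ≤ j →
      lamAt ζ (k + c j) ≤ max (m + ε (g j) + 3 * (16 / 25) ^ (g j)) (18 / 5) := by
    intro j hj k h1 h2
    rw [← lamAt_comp_add]
    exact (hη (g j)).2.2 j (hNg j hj) _ (hshift j) (fun i => hζc j i) k h1 h2
  have hlower : ∀ j, g j ≤ j → m - 2 * (16 / 25) ^ (g j) ≤ lamAt ζ (c j) := by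
    intro j hj
    have := abs_lamAt_sub_le (hshift j) hα 0 (g j) fun i h1 h2 => by
      rw [hζc j i (by omega) (by omega), (hη (g j)).2.1 i (by omega) (by omega)]
    rw [lamAt_comp_add, hαm, zero_add, abs_le] at this
    linarith [this.1]
  have hpow : Tendsto (fun j => (16 / 25 : ℝ) ^ (g j)) atTop (nhds 0) :=
    (tendsto_pow_atTop_nhds_zero_of_lt_one (by norm_num) (by norm_num)).comp hgtop
  have hbdd : IsBoundedUnder (· ≤ ·) atTop fun n : ℕ => lamAt ζ n :=
    isBoundedUnder_of ⟨5, fun n => (lamAt_mem_Icc hζ n).2⟩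
  have hbdd' : IsBoundedUnder (· ≥ ·) atTop fun n : ℕ => lamAt ζ n :=
    isBoundedUnder_of ⟨0, fun n => (lamAt_mem_Icc hζ n).1⟩
  refine ⟨ζ, fun i => (hζ i).1, ?_⟩
  have hfun : lagrangeValue ζ = limsup (fun n : ℕ => lamAt ζ n) atTop := by
    unfold lagrangeValue
    congr 1
    funext n
    exact lambda0_shiftZ (fun i => (hζ i).1) _
  rw [hfun]
  refine le_antisymm (le_of_forall_pos_le_add fun δ hδ => ?_)
    (le_of_forall_pos_le_add fun δ hδ => ?_)
  · refine limsup_le_of_le hbdd'.isCoboundedUnder_le ?_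
    have hlim : Tendsto (fun j => m + ε (g j) + 3 * (16 / 25 : ℝ) ^ (g j)) atTop (nhds m) := by
      simpa using (tendsto_const_nhds.add (hε.comp hgtop)).add (hpow.const_mul 3)
    have hev := (hlim.eventually_lt_const (by linarith : m < m + δ)).and (eventually_ge_atTop (N 0))
    obtain ⟨J, hJ⟩ := eventually_atTop.1 hev
    refine eventually_atTop.2 ⟨J * J, fun n hn => ?_⟩
    obtain ⟨h1, h2⟩ := hJ (Nat.sqrt n) (Nat.le_sqrt.2 hn)
    have h3 := Nat.sqrt_le n
    have h4 := Nat.sqrt_le_add n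
    have := hupper (Nat.sqrt n) h2 (n - c (Nat.sqrt n)) (by simp only [hc]; omega)
      (by simp only [hc]; omega)
    rw [sub_add_cancel] at this
    exact this.trans (max_le h1.le (by linarith))
  · rw [← sub_le_iff_le_add]
    refine le_limsup_of_frequently_le ?_ hbdd
    have hlim : Tendsto (fun j => m - 2 * (16 / 25 : ℝ) ^ (g j)) atTop (nhds m) := by
      simpa using tendsto_const_nhds.sub (hpow.const_mul 2)
    obtain ⟨J, hJ⟩ := eventually_atTop.1
      (hlim.eventually_const_lt (by linarith : m - δ < m))
    refine frequently_atTop.2 fun n => ⟨max n J * max n J + max n J, ?_, ?_⟩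
    · exact (le_max_left n J).trans (Nat.le_add_left _ _)
    · exact (hJ (max n J) (le_max_right _ _)).le.trans
        (hlower (max n J) (Nat.findGreatest_le _))

/-! ### Attaining the Markov value -/

lemma isCompact_digitsLeThree : IsCompact {α : ℤ → ℕ | DigitsLeThree α} := by
  have : {α : ℤ → ℕ | DigitsLeThree α} = Set.univ.pi fun _ => Set.Icc 1 3 := by
    ext α; simp only [DigitsLeThree, Set.mem_ofPred_eq, Set.mem_univ_pi, Set.mem_Icc]
  rw [this]
  exact isCompact_univ_pi fun _ => (Set.finite_Icc 1 3).isCompact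

lemma continuousOn_lamAt (k : ℤ) : ContinuousOn (fun α => lamAt α k) {α | DigitsLeThree α} := by
  intro α hα
  rw [ContinuousWithinAt, Metric.tendsto_nhds]
  intro ε hε
  obtain ⟨n, hn⟩ := exists_pow_lt_of_lt_one (half_pos hε) (by norm_num : (16 / 25 : ℝ) < 1)
  have hev : ∀ᶠ β in nhds α, ∀ i ∈ Finset.Icc (k - n) (k + n), β i = α i :=
    (eventually_all_finset _).2 fun i _ =>
      (continuous_apply (A := fun _ : ℤ => ℕ) i).continuousAt.eventually_mem (s := {α i})
        (mem_nhds_discrete.2 rfl)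
  filter_upwards [mem_nhdsWithin_of_mem_nhds hev, self_mem_nhdsWithin] with β hβ hβd
  have := abs_lamAt_sub_le hβd hα k n fun i h1 h2 => hβ i (Finset.mem_Icc.2 ⟨h1, h2⟩)
  rw [Real.dist_eq]
  linarith

lemma isCompact_markovSublevel (t : ℝ) : IsCompact (markovSublevel t) := by
  have : markovSublevel t = ⋂ k : ℤ, {α | DigitsLeThree α} ∩ (fun α => lamAt α k) ⁻¹' Set.Iic t := by
    ext α; simp [markovSublevel, forall_and]
  rw [this]
  refine isCompact_digitsLeThree.of_isClosed_subset (isClosed_iInter fun k =>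
    (continuousOn_lamAt k).preimage_isClosed_of_isClosed isCompact_digitsLeThree.isClosed
      isClosed_Iic) ?_
  exact (Set.iInter_subset _ 0).trans Set.inter_subset_left

lemma exists_attaining {m : ℝ} (hm : m ∈ MarkovSpectrum) (h0 : 0 < m) (h4 : m < 4) :
    ∃ α ∈ markovSublevel m, lamAt α 0 = m := by
  obtain ⟨α, hα, rfl⟩ := hm
  have hval : ∀ n, lambda0 (shiftZ n α) = lamAt α n := lambda0_shiftZ hα
  have hbdd : BddAbove (Set.range fun n : ℤ => lambda0 (shiftZ n α)) := by
    by_contra h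
    rw [markovValue, iSup, Real.sSup_of_not_bddAbove h] at h0
    exact lt_irrefl _ h0
  have hle : ∀ n, lamAt α n ≤ markovValue α := fun n => by
    rw [← hval]; exact le_ciSup hbdd n
  have hd : DigitsLeThree α := fun i => by
    refine ⟨hα i, ?_⟩
    have h1 : 0 < rightCF α (i + 1) := cf01_pos fun _ => hα _
    have h2 : 0 < leftCF α (i - 1) := cf01_pos fun _ => hα _
    have h3 := hle i
    unfold lamAt at h3
    have : (α i : ℝ) < 4 := by linarith
    have : α i < 4 := by exact_mod_cast this
    omega
  have hmem : ∀ n : ℤ, (fun i => α (i + n)) ∈ markovSublevel (markovValue α) := fun n =>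
    ⟨fun i => hd _, fun k => by rw [lamAt_comp_add]; exact hle _⟩
  obtain ⟨β, hβ, hmax⟩ := (isCompact_markovSublevel (markovValue α)).exists_isMaxOn ⟨_, hmem 0⟩
    ((continuousOn_lamAt 0).mono fun _ h => h.1)
  refine ⟨β, hβ, le_antisymm (hβ.2 0) (ciSup_le fun n => ?_)⟩
  have := hmax (hmem n)
  simpa [hval, lamAt_comp_add] using this

/-! ### Comparison with a Gauss–Cantor set -/

lemma cf01_mem_gaussCantor {a : ℕ → ℕ} (ha : ∀ n, 1 ≤ a n ∧ a n ≤ 3)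
    (h13 : ∀ n, ¬(a n = 1 ∧ a (n + 1) = 3)) (h31 : ∀ n, ¬(a n = 3 ∧ a (n + 1) = 1)) :
    cf01 a ∈ gaussCantor {1, 2, 3} forbiddenC2 := by
  refine ⟨a, fun n => ?_, fun w hw i hi => ?_, rfl⟩
  · have := ha n
    simp only [Set.mem_insert_iff, Set.mem_singleton_iff]
    omega
  · simp only [forbiddenC2, List.mem_cons, List.not_mem_nil, or_false] at hw
    rcases hw with rfl | rfl
    · exact h13 i ⟨by simpa using hi 0 (by simp), by simpa using hi 1 (by simp)⟩
    · exact h31 i ⟨by simpa using hi 0 (by simp), by simpa using hi 1 (by simp)⟩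

lemma rightCF_mem_gaussCantor {α : ℤ → ℕ} {t : ℝ} (hα : α ∈ markovSublevel t) (ht : t < 3.84)
    (k : ℤ) : rightCF α k ∈ gaussCantor {1, 2, 3} forbiddenC2 := by
  refine cf01_mem_gaussCantor (fun n => hα.1 _) (fun n h => ?_) fun n h => ?_
  · refine not_one_three hα ht (k + n) ⟨h.1, ?_⟩
    rw [← h.2]; congr 1; push_cast; ring
  · refine not_three_one hα ht (k + n) ⟨h.1, ?_⟩
    rw [← h.2]; congr 1; push_cast; ring

lemma leftCF_mem_gaussCantor {α : ℤ → ℕ} {t : ℝ} (hα : α ∈ markovSublevel t) (ht : t < 3.84)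
    (k : ℤ) : leftCF α k ∈ gaussCantor {1, 2, 3} forbiddenC2 := by
  have := rightCF_mem_gaussCantor (reflect_mem_markovSublevel hα) ht (-k)
  rwa [rightCF_reflect, neg_neg] at this

/-- The values at the origin of the members of `markovSublevel t` that coincide with `w` on
`[-W, W]`. -/
def windowValues (t : ℝ) (W : ℕ) (w : ℤ → ℕ) : Set ℝ :=
  {x | ∃ α ∈ markovSublevel t, (∀ i : ℤ, -W ≤ i → i ≤ W → α i = w i) ∧ lamAt α 0 = x}

/-- The window of `w` on `[-W, W]` has at most one continuation to the right in
`markovSublevel t`. -/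
def RightUnique (t : ℝ) (W : ℕ) (w : ℤ → ℕ) : Prop :=
  ∀ β ∈ markovSublevel t, ∀ β' ∈ markovSublevel t, (∀ i : ℤ, -W ≤ i → i ≤ W → β i = w i) →
    (∀ i : ℤ, -W ≤ i → i ≤ W → β' i = w i) → ∀ i : ℤ, W < i → β i = β' i

/-- The window of `w` on `[-W, W]` has at most one continuation to the left in
`markovSublevel t`. -/
def LeftUnique (t : ℝ) (W : ℕ) (w : ℤ → ℕ) : Prop :=
  ∀ β ∈ markovSublevel t, ∀ β' ∈ markovSublevel t, (∀ i : ℤ, -W ≤ i → i ≤ W → β i = w i) →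
    (∀ i : ℤ, -W ≤ i → i ≤ W → β' i = w i) → ∀ i : ℤ, i < -W → β i = β' i

lemma dimH_windowValues_le {t : ℝ} (ht : t < 3.84) {W : ℕ} {w : ℤ → ℕ}
    (h : RightUnique t W w ∨ LeftUnique t W w) :
    dimH (windowValues t W w) ≤ dimH (gaussCantor {1, 2, 3} forbiddenC2) := by
  suffices ∃ c : ℝ, windowValues t W w ⊆ (fun x => c + x) '' gaussCantor {1, 2, 3} forbiddenC2 by
    obtain ⟨c, hc⟩ := this
    exact (dimH_mono hc).trans ((isometry_add_left c).dimH_image _).le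
  by_cases hne : ∃ α ∈ markovSublevel t, ∀ i : ℤ, -W ≤ i → i ≤ W → α i = w i
  swap
  · exact ⟨0, fun x ⟨α, hα, hw, _⟩ => absurd ⟨α, hα, hw⟩ hne⟩
  obtain ⟨α, hα, hw⟩ := hne
  rcases h with h | h
  · refine ⟨α 0 + rightCF α 1, ?_⟩
    rintro _ ⟨β, hβ, hβw, rfl⟩
    have hr : ∀ i : ℤ, 0 ≤ i → β i = α i := fun i hi => by
      rcases le_or_gt i W with h1 | h1
      · rw [hβw i (by omega) h1, hw i (by omega) h1]
      · exact h β hβ α hα hβw hw i h1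
    refine ⟨leftCF β (-1), leftCF_mem_gaussCantor hβ ht _, ?_⟩
    have : rightCF β 1 = rightCF α 1 := by
      unfold rightCF
      congr 1
      funext n
      exact hr _ (by omega)
    simp [lamAt, hr 0 le_rfl, this]
  · refine ⟨α 0 + leftCF α (-1), ?_⟩
    rintro _ ⟨β, hβ, hβw, rfl⟩
    have hr : ∀ i : ℤ, i ≤ 0 → β i = α i := fun i hi => by
      rcases le_or_gt (-W : ℤ) i with h1 | h1
      · rw [hβw i h1 (by omega), hw i h1 (by omega)]
      · exact h β hβ α hα hβw hw i h1
    refine ⟨rightCF β 1, rightCF_mem_gaussCantor hβ ht _, ?_⟩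
    have : leftCF β (-1) = leftCF α (-1) := by
      unfold leftCF
      congr 1
      funext n
      exact hr _ (by omega)
    simp only [lamAt, hr 0 le_rfl, zero_add, zero_sub, this]
    ring

lemma exists_unique_side {m : ℝ} (h1 : 18 / 5 < m) (h2 : m < 3.84) (hL : m ∉ LagrangeSpectrum)
    {α : ℤ → ℕ} (hα : DigitsLeThree α) (hαm : lamAt α 0 = m) :
    ∃ t, m < t ∧ t < 3.84 ∧ ∃ W : ℕ, RightUnique t W α ∨ LeftUnique t W α := by
  set ε : ℕ → ℝ := fun W => (3.84 - m) / (W + 2) with hε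
  have hpos : ∀ W, 0 < ε W := fun W => div_pos (by linarith) (by positivity)
  have hlt : ∀ W, m + ε W < 3.84 := fun W => by
    have : ε W < 3.84 - m := div_lt_self (by linarith) (by
      have : (0 : ℝ) ≤ W := Nat.cast_nonneg W
      linarith)
    linarith
  have hlim : Tendsto ε atTop (nhds 0) :=
    tendsto_const_nhds.div_atTop (tendsto_atTop_add_const_right _ _ tendsto_natCast_atTop_atTop)
  by_contra hcon
  have key : ∀ W : ℕ, ∃ η N, Connects (m + ε W) W α η N := fun W => by
    have hW : ¬(RightUnique (m + ε W) W α ∨ LeftUnique (m + ε W) W α) := fun h =>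
      hcon ⟨_, by linarith [hpos W], hlt W, W, h⟩
    rw [not_or] at hW
    simp only [RightUnique, LeftUnique, not_forall] at hW
    obtain ⟨⟨β, hβ, β', hβ', hβα, hβα', i, hi, hne⟩, γ, hγ, γ', hγ', hγα, hγα', j, hj, hne'⟩ := hW
    exact exists_connects (hlt W) hβ hβ' hγ hγ' hβα hβα' hγα hγα' ⟨i, hi, hne⟩ ⟨j, hj, hne'⟩
  choose η N hηN using key
  exact hL (mem_LagrangeSpectrum_of_connects h1 hα hαm hlim hηN)

lemma markovSublevel_mono {s t : ℝ} (h : s ≤ t) : markovSublevel s ⊆ markovSublevel t :=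
  fun _ hα => ⟨hα.1, fun k => (hα.2 k).trans h⟩

/-- A finite list read as a window centred at position `W`. -/
def listWindow (W : ℕ) (l : List ℕ) (i : ℤ) : ℕ := l.getD (i + W).toNat 0

lemma exists_listWindow_eq (W : ℕ) (α : ℤ → ℕ) :
    ∃ l : List ℕ, ∀ i : ℤ, -W ≤ i → i ≤ W → listWindow W l i = α i := by
  refine ⟨(List.range (2 * W + 1)).map fun n : ℕ => α (n - W), fun i h1 h2 => ?_⟩
  have h3 : (i + W).toNat < 2 * W + 1 := by omega
  simp [listWindow, List.getD_eq_getElem?_getD, h3, max_eq_left (by omega : 0 ≤ i + W)]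

lemma diff_subset_iUnion_windowValues :
    (MarkovSpectrum \ LagrangeSpectrum) ∩ Set.Ioo (Real.sqrt 13) 3.84 ⊆
      ⋃ p : {p : ℚ × ℕ × List ℕ // (p.1 : ℝ) < 3.84 ∧
          (RightUnique p.1 p.2.1 (listWindow p.2.1 p.2.2) ∨
            LeftUnique p.1 p.2.1 (listWindow p.2.1 p.2.2))},
        windowValues p.1.1 p.1.2.1 (listWindow p.1.2.1 p.1.2.2) := by
  rintro m ⟨⟨hM, hL⟩, h1, h2⟩
  have h1' : 18 / 5 < m := lt_trans (Real.lt_sqrt_of_sq_lt (by norm_num)) h1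
  obtain ⟨α, hα, hαm⟩ := exists_attaining hM (by linarith) (by linarith)
  obtain ⟨t, hmt, ht, W, hW⟩ := exists_unique_side h1' h2 hL hα.1 hαm
  obtain ⟨q, hmq, hqt⟩ := exists_rat_btwn hmt
  obtain ⟨l, hl⟩ := exists_listWindow_eq W α
  have hsub := markovSublevel_mono hqt.le
  refine Set.mem_iUnion.2 ⟨⟨⟨q, W, l⟩, hqt.trans ht, hW.imp (fun h => ?_) fun h => ?_⟩,
    α, markovSublevel_mono hmq.le hα, fun i hi hi' => (hl i hi hi').symm, hαm⟩
  all_goals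
    exact fun β hβ β' hβ' e e' => h β (hsub hβ) β' (hsub hβ')
      (fun i hi hi' => (e i hi hi').trans (hl i hi hi'))
      fun i hi hi' => (e' i hi hi').trans (hl i hi hi')

lemma dimH_diff_le :
    dimH ((MarkovSpectrum \ LagrangeSpectrum) ∩ Set.Ioo (Real.sqrt 13) 3.84) ≤
      dimH (gaussCantor {1, 2, 3} forbiddenC2) := by
  refine (dimH_mono diff_subset_iUnion_windowValues).trans ?_
  rw [dimH_iUnion]
  exact iSup_le fun p => dimH_windowValues_le p.2.1 p.2.2

/-! ### Branches of the continued fraction and their contraction -/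

/-- `y ↦ [0; aₙ, …, a₁ + y]` for the word `a₁ … aₙ`. -/
noncomputable def cfBranch : List ℕ → ℝ → ℝ
  | [], y => y
  | a :: w, y => cfBranch w (1 / (a + y))

/-- The affine function `y ↦ A + B y` appearing as the denominator of `cfBranch`. -/
noncomputable def cfScale : List ℕ → ℝ → ℝ
  | [], _ => 1
  | a :: w, y => (a + y) * cfScale w (1 / (a + y))

lemma exists_cfScale_eq {w : List ℕ} (hw : ∀ a ∈ w, 1 ≤ a) :
    ∃ A B : ℝ, 0 < A ∧ 0 ≤ B ∧ ∀ y, 0 ≤ y → cfScale w y = A + B * y := by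
  induction w with
  | nil => exact ⟨1, 0, one_pos, le_rfl, fun y _ => by simp [cfScale]⟩
  | cons a w ih =>
    obtain ⟨A, B, hA, hB, h⟩ := ih fun b hb => hw b (List.mem_cons_of_mem _ hb)
    have ha : (1 : ℝ) ≤ a := by exact_mod_cast hw a List.mem_cons_self
    refine ⟨a * A + B, A, by positivity, hA.le, fun y hy => ?_⟩
    have hay : (0 : ℝ) < a + y := by linarith
    rw [cfScale, h _ (by positivity)]
    field_simp
    ring

lemma cfScale_pos {w : List ℕ} (hw : ∀ a ∈ w, 1 ≤ a) {y : ℝ} (hy : 0 ≤ y) : 0 < cfScale w y := by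
  obtain ⟨A, B, hA, hB, h⟩ := exists_cfScale_eq hw
  rw [h y hy]
  positivity

lemma cfScale_mono {w : List ℕ} (hw : ∀ a ∈ w, 1 ≤ a) {x y : ℝ} (hx : 0 ≤ x) (hxy : x ≤ y) :
    cfScale w x ≤ cfScale w y := by
  obtain ⟨A, B, hA, hB, h⟩ := exists_cfScale_eq hw
  rw [h x hx, h y (hx.trans hxy)]
  gcongr

lemma cfScale_le_four_mul {w : List ℕ} (hw : ∀ a ∈ w, 1 ≤ a) {y : ℝ} (hy : 0 ≤ y) (hy1 : y ≤ 1) :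
    cfScale w y ≤ 4 * cfScale w (1 / 4) := by
  obtain ⟨A, B, hA, hB, h⟩ := exists_cfScale_eq hw
  rw [h y hy, h (1 / 4) (by norm_num)]
  nlinarith

lemma convexOn_cfScale_rpow {w : List ℕ} (hw : ∀ a ∈ w, 1 ≤ a) {p : ℝ} (hp : 0 ≤ p) :
    ConvexOn ℝ (Set.Ici 0) fun y => cfScale w y ^ (-p) := by
  obtain ⟨A, B, hA, hB, h⟩ := exists_cfScale_eq hw
  refine ⟨convex_Ici 0, fun x hx y hy a b ha hb hab => ?_⟩
  have hx' : 0 < cfScale w x := cfScale_pos hw hx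
  have hy' : 0 < cfScale w y := cfScale_pos hw hy
  have hcomb : 0 ≤ a • x + b • y := (convex_Ici (0 : ℝ)) hx hy ha hb hab
  have hlin : cfScale w (a • x + b • y) = a • cfScale w x + b • cfScale w y := by
    rw [h _ hcomb, h x hx, h y hy]
    simp only [smul_eq_mul]
    linear_combination (-A) * hab
  have hlog := strictConcaveOn_log_Ioi.concaveOn.2 hx' hy' ha hb hab
  have hexp := convexOn_exp.2 (Set.mem_univ (Real.log (cfScale w x) * -p))
    (Set.mem_univ (Real.log (cfScale w y) * -p)) ha hb hab
  simp only
  rw [Real.rpow_def_of_pos (cfScale_pos hw hcomb), Real.rpow_def_of_pos hx',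
    Real.rpow_def_of_pos hy', hlin]
  refine (Real.exp_le_exp.2 ?_).trans hexp
  simp only [smul_eq_mul] at hlog ⊢
  nlinarith

lemma abs_cfBranch_sub {w : List ℕ} (hw : ∀ a ∈ w, 1 ≤ a) {x y : ℝ} (hx : 0 ≤ x) (hy : 0 ≤ y) :
    |cfBranch w x - cfBranch w y| = |x - y| / (cfScale w x * cfScale w y) := by
  induction w generalizing x y with
  | nil => simp [cfBranch, cfScale]
  | cons a w ih =>
    have hw' : ∀ b ∈ w, 1 ≤ b := fun b hb => hw b (List.mem_cons_of_mem _ hb)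
    have ha : (1 : ℝ) ≤ a := by exact_mod_cast hw a List.mem_cons_self
    have hax : (0 : ℝ) < a + x := by linarith
    have hay : (0 : ℝ) < a + y := by linarith
    have h1 := cfScale_pos hw' (one_div_pos.2 hax).le
    have h2 := cfScale_pos hw' (one_div_pos.2 hay).le
    have e : (1 / (a + x) - 1 / (a + y) : ℝ) = (y - x) / ((a + x) * (a + y)) := by
      field_simp
      ring
    rw [cfBranch, cfBranch, ih hw' (by positivity) (by positivity), e, abs_div,
      abs_of_pos (mul_pos hax hay), abs_sub_comm, cfScale, cfScale]
    field_simp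

lemma pow_le_cfScale {w : List ℕ} (hw : ∀ a ∈ w, 1 ≤ a ∧ a ≤ 3) {y : ℝ}
    (hy : y ∈ Set.Icc (1 / 4 : ℝ) 1) : (5 / 4) ^ w.length ≤ cfScale w y := by
  induction w generalizing y with
  | nil => simp [cfScale]
  | cons a w ih =>
    have ha : (1 : ℝ) ≤ a := by exact_mod_cast (hw a List.mem_cons_self).1
    have ha3 : (a : ℝ) ≤ 3 := by exact_mod_cast (hw a List.mem_cons_self).2
    have := ih (fun b hb => hw b (List.mem_cons_of_mem _ hb)) (y := 1 / (a + y))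
      ⟨one_div_le_one_div_of_le (by linarith [hy.1]) (by linarith [hy.2]),
        (div_le_one (by linarith [hy.1])).2 (by linarith [hy.1])⟩
    rw [List.length_cons, pow_succ', cfScale]
    exact mul_le_mul (by linarith [hy.1]) this (by positivity) (by linarith [hy.1])

/-- Words of length `n` over `{1, 2, 3}` such that, after prepending the digit `d`, no two
neighbouring letters are `1` and `3` in some order. -/
def cfWords : ℕ → ℕ → List (List ℕ)
  | 0, _ => [[]]
  | n + 1, d => ([1, 2, 3].filter (· * d ≠ 3)).flatMap fun a => (cfWords n a).map (a :: ·)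

lemma mem_cfWords {n d : ℕ} {w : List ℕ} (hw : w ∈ cfWords n d) :
    w.length = n ∧ ∀ a ∈ w, 1 ≤ a ∧ a ≤ 3 := by
  induction n generalizing d w with
  | zero =>
    obtain rfl : w = [] := by simpa [cfWords] using hw
    simp
  | succ n ih =>
    simp only [cfWords, List.mem_flatMap, List.mem_filter, List.mem_map] at hw
    obtain ⟨a, ⟨ha, -⟩, w, hw, rfl⟩ := hw
    obtain ⟨h1, h2⟩ := ih hw
    refine ⟨by simp [h1], fun b hb => ?_⟩
    rcases List.mem_cons.1 hb with rfl | hb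
    · simp only [List.mem_cons, List.not_mem_nil, or_false] at ha
      omega
    · exact h2 b hb

/-- The sum of `cfScale w y ^ (-p)` over the words `w` in `cfWords n d`. -/
noncomputable def scaleSum (p : ℝ) (n d : ℕ) (y : ℝ) : ℝ :=
  ((cfWords n d).map fun w => cfScale w y ^ (-p)).sum

lemma scaleSum_nonneg (p : ℝ) (n d : ℕ) {y : ℝ} (hy : 0 ≤ y) : 0 ≤ scaleSum p n d y := by
  refine List.sum_nonneg fun x hx => ?_
  obtain ⟨w, hw, rfl⟩ := List.mem_map.1 hx
  exact Real.rpow_nonneg (cfScale_pos (fun a ha => ((mem_cfWords hw).2 a ha).1) hy).le _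

lemma convexOn_scaleSum {p : ℝ} (hp : 0 ≤ p) (n d : ℕ) :
    ConvexOn ℝ (Set.Ici 0) (scaleSum p n d) := by
  have : ∀ l : List (List ℕ), (∀ w ∈ l, ∀ a ∈ w, 1 ≤ a) →
      ConvexOn ℝ (Set.Ici 0) fun y => (l.map fun w => cfScale w y ^ (-p)).sum := by
    intro l hl
    induction l with
    | nil => simpa using convexOn_const (0 : ℝ) (convex_Ici (0 : ℝ))
    | cons w l ih =>
      simp only [List.map_cons, List.sum_cons]
      exact (convexOn_cfScale_rpow (hl w List.mem_cons_self) hp).add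
        (ih fun v hv => hl v (List.mem_cons_of_mem _ hv))
  exact this _ fun w hw a ha => ((mem_cfWords hw).2 a ha).1

lemma scaleSum_succ (p : ℝ) (n d : ℕ) {y : ℝ} (hy : 0 ≤ y) :
    scaleSum p (n + 1) d y = (([1, 2, 3].filter (· * d ≠ 3)).map fun a : ℕ =>
      (a + y) ^ (-p) * scaleSum p n a (1 / (a + y))).sum := by
  have hmul : ∀ (a : ℕ), 1 ≤ a → ((cfWords n a).map fun w => cfScale (a :: w) y ^ (-p)).sum =
      (a + y) ^ (-p) * scaleSum p n a (1 / (a + y)) := by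
    intro a ha
    have ha' : (1 : ℝ) ≤ a := by exact_mod_cast ha
    rw [scaleSum, ← List.sum_map_mul_left]
    congr 1
    refine List.map_congr_left fun w hw => ?_
    rw [cfScale, Real.mul_rpow (by linarith) (cfScale_pos
      (fun b hb => ((mem_cfWords hw).2 b hb).1) (one_div_nonneg.2 (by linarith))).le]
  have : ∀ l : List ℕ, (∀ a ∈ l, 1 ≤ a) →
      (((l.flatMap fun a => (cfWords n a).map (a :: ·))).map fun w => cfScale w y ^ (-p)).sum =
      (l.map fun a : ℕ => (a + y) ^ (-p) * scaleSum p n a (1 / (a + y))).sum := by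
    intro l hl
    induction l with
    | nil => simp
    | cons a l ih =>
      rw [List.flatMap_cons, List.map_append, List.sum_append,
        ih fun b hb => hl b (List.mem_cons_of_mem _ hb), List.map_cons, List.sum_cons,
        ← hmul a (hl a List.mem_cons_self), List.map_map]
      rfl
  refine this _ fun a ha => ?_
  have := (List.mem_filter.1 ha).1
  simp only [List.mem_cons, List.not_mem_nil, or_false] at this
  omega

/-- The word `a (n - 1) … a 0`. -/
def reversedInit (a : ℕ → ℕ) : ℕ → List ℕ
  | 0 => []
  | n + 1 => a n :: reversedInit a n

lemma cfBranch_reversedInit {a : ℕ → ℕ} (ha : ∀ n, 1 ≤ a n) (n : ℕ) :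
    cfBranch (reversedInit a n) (cf01 fun k => a (n + k)) = cf01 a := by
  induction n with
  | zero => simp [reversedInit, cfBranch]
  | succ n ih =>
    rw [← ih, cf01_eq (a := fun k => a (n + k)) fun _ => ha _, reversedInit, cfBranch]
    simp only [add_zero, ← add_assoc, add_right_comm]

lemma reversedInit_mem_cfWords {a : ℕ → ℕ} (ha : ∀ n, 1 ≤ a n ∧ a n ≤ 3)
    (hadj : ∀ n, a n * a (n + 1) ≠ 3) (n d : ℕ) (hd : ∀ k, k + 1 = n → a k * d ≠ 3) :
    reversedInit a n ∈ cfWords n d := by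
  induction n generalizing d with
  | zero => simp [reversedInit, cfWords]
  | succ n ih =>
    simp only [reversedInit, cfWords, List.mem_flatMap, List.mem_map]
    refine ⟨a n, List.mem_filter.2 ⟨?_, by simpa using hd n rfl⟩, _,
      ih (a n) fun k hk => hk ▸ hadj k, rfl⟩
    have := ha n
    simp only [List.mem_cons, List.not_mem_nil, or_false]
    omega

open MeasureTheory in
lemma dimH_gaussCantor_le {s : NNReal} {y : ℝ} (hy : 0 ≤ y) (hy1 : y ≤ 1)
    (h : Tendsto (fun n => scaleSum (2 * s) n 2 y) atTop (nhds 0)) :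
    dimH (gaussCantor {1, 2, 3} forbiddenC2) ≤ s := by
  refine dimH_le_of_hausdorffMeasure_ne_top (ne_of_lt ?_)
  have hr : Tendsto (fun n : ℕ => ENNReal.ofReal ((16 / 25) ^ n)) atTop (nhds 0) := by
    have := ENNReal.tendsto_ofReal (tendsto_pow_atTop_nhds_zero_of_lt_one
      (by norm_num : (0 : ℝ) ≤ 16 / 25) (by norm_num))
    rwa [ENNReal.ofReal_zero] at this
  have hone : ∀ {n} {w : List ℕ}, w ∈ cfWords n 2 → ∀ a ∈ w, 1 ≤ a :=
    fun hw a ha => ((mem_cfWords hw).2 a ha).1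
  have hdiam : ∀ {n} {w : List ℕ}, w ∈ cfWords n 2 →
      Metric.ediam (cfBranch w '' Set.Icc (1 / 4) 1) ≤ ENNReal.ofReal (cfScale w (1 / 4) ^ 2)⁻¹ := by
    intro n w hw
    have hpos := cfScale_pos (hone hw) (by norm_num : (0 : ℝ) ≤ 1 / 4)
    refine Metric.ediam_le ?_
    rintro _ ⟨u, hu, rfl⟩ _ ⟨v, hv, rfl⟩
    rw [edist_dist, Real.dist_eq]
    refine ENNReal.ofReal_le_ofReal ?_
    have hu0 : (0 : ℝ) ≤ u := by linarith [hu.1]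
    have hv0 : (0 : ℝ) ≤ v := by linarith [hv.1]
    rw [abs_cfBranch_sub (hone hw) hu0 hv0, inv_eq_one_div, sq]
    refine div_le_div₀ zero_le_one ?_ (mul_pos hpos hpos) (mul_le_mul
      (cfScale_mono (hone hw) (by norm_num) hu.1) (cfScale_mono (hone hw) (by norm_num) hv.1)
      hpos.le (cfScale_pos (hone hw) hu0).le)
    rw [abs_le]
    constructor <;> linarith [hu.1, hu.2, hv.1, hv.2]
  refine (Measure.hausdorffMeasure_le_liminf_sum (ι := fun n => Fin (cfWords n 2).length) (s : ℝ)
    _ _ hr (fun n i => cfBranch (cfWords n 2)[i] '' Set.Icc (1 / 4) 1)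
    (Eventually.of_forall fun n i => (hdiam (List.getElem_mem i.2)).trans ?_)
    (Eventually.of_forall fun n => ?_)).trans_lt ?_
  · refine ENNReal.ofReal_le_ofReal ?_
    obtain ⟨hlen, hdig⟩ := mem_cfWords (List.getElem_mem i.2)
    have := pow_le_cfScale hdig (y := 1 / 4) ⟨le_rfl, by norm_num⟩
    rw [hlen] at this
    calc _ ≤ (((5 / 4 : ℝ) ^ n) ^ 2)⁻¹ := by
          gcongr
      _ = (16 / 25) ^ n := by
          rw [← pow_mul, mul_comm, pow_mul, ← inv_pow]
          norm_num
  · rintro _ ⟨a, ha, hF, rfl⟩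
    have ha3 : ∀ n, 1 ≤ a n ∧ a n ≤ 3 := fun n => by
      have := ha n
      simp only [Set.mem_insert_iff, Set.mem_singleton_iff] at this
      omega
    have hF' : ∀ w ∈ forbiddenC2, ∀ n, w.length = 2 → ¬(a n = w.getD 0 0 ∧ a (n + 1) = w.getD 1 0) :=
      fun w hw n hl h => hF w hw n fun j hj => by
        rcases (by omega : j = 0 ∨ j = 1) with rfl | rfl
        exacts [h.1, h.2]
    have hadj : ∀ n, a n * a (n + 1) ≠ 3 := fun n hn => by
      have h1 := hF' [1, 3] (by simp [forbiddenC2]) n rfl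
      have h2 := hF' [3, 1] (by simp [forbiddenC2]) n rfl
      have h3 := ha3 n
      have h4 := ha3 (n + 1)
      simp only [List.getD_cons_zero, List.getD_cons_succ] at h1 h2
      generalize a n = x at *
      generalize a (n + 1) = z at *
      obtain ⟨h3, h3'⟩ := h3
      obtain ⟨h4, h4'⟩ := h4
      interval_cases x <;> interval_cases z <;> omega
    obtain ⟨i, hi, hi'⟩ := List.getElem_of_mem
      (reversedInit_mem_cfWords ha3 hadj n 2 fun k _ => by omega)
    refine Set.mem_iUnion.2 ⟨⟨i, hi⟩, cf01 fun k => a (n + k), ?_, ?_⟩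
    · have := cf01_mem_Icc (a := fun k => a (n + k)) fun _ => ha3 _
      exact ⟨this.1, this.2.trans (by norm_num)⟩
    · simp only [Fin.getElem_fin, hi']
      exact cfBranch_reversedInit (fun n => (ha3 n).1) n
  · have hterm : ∀ n, ∑ i : Fin (cfWords n 2).length,
        Metric.ediam (cfBranch (cfWords n 2)[i] '' Set.Icc (1 / 4) 1) ^ (s : ℝ) ≤
        ENNReal.ofReal (4 ^ (2 * s : ℝ) * scaleSum (2 * s) n 2 y) := by
      intro n
      rw [scaleSum, ← List.sum_map_mul_left, ← Fin.sum_univ_fun_getElem, ENNReal.ofReal_sum_of_nonneg]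
      · refine Finset.sum_le_sum fun i _ => ?_
        have hw := hone (List.getElem_mem i.2)
        have hpos := cfScale_pos hw (by norm_num : (0 : ℝ) ≤ 1 / 4)
        refine (ENNReal.rpow_le_rpow (hdiam (List.getElem_mem i.2)) s.2).trans ?_
        rw [ENNReal.ofReal_rpow_of_nonneg (by positivity) s.2]
        refine ENNReal.ofReal_le_ofReal ?_
        have h4 := cfScale_le_four_mul hw hy hy1
        have hy' := cfScale_pos hw hy
        calc _ = 4 ^ (2 * s : ℝ) * (4 * cfScale (cfWords n 2)[(i : ℕ)] (1 / 4)) ^ (-(2 * s : ℝ)) := by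
              rw [Real.mul_rpow (by norm_num) hpos.le, ← mul_assoc,
                ← Real.rpow_add (by norm_num), add_neg_cancel, Real.rpow_zero, one_mul,
                ← Real.rpow_natCast, ← Real.rpow_neg hpos.le, ← Real.rpow_mul hpos.le]
              norm_num
          _ ≤ _ := by
              gcongr 4 ^ (2 * s : ℝ) * ?_
              exact Real.rpow_le_rpow_of_nonpos hy' h4 (by simp)
      · exact fun i _ => mul_nonneg (by positivity)
          (Real.rpow_nonneg (cfScale_pos (hone (List.getElem_mem i.2)) hy).le _)
    have hlim : Tendsto (fun n => ENNReal.ofReal (4 ^ (2 * s : ℝ) * scaleSum (2 * s) n 2 y)) atTop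
        (nhds 0) := by
      have := ENNReal.tendsto_ofReal (h.const_mul (4 ^ (2 * s : ℝ)))
      rwa [mul_zero, ENNReal.ofReal_zero] at this
    refine lt_of_le_of_lt ((liminf_le_liminf (Eventually.of_forall hterm)).trans_eq
      hlim.liminf_eq) ENNReal.zero_lt_top

/-! ### The numerical estimate -/

/-- Mesh points, each given by the digit `d` whose cylinder it lies in and its abscissa. -/
def meshPoint : Fin 13 → ℕ × ℚ :=
  ![(1, 5773 / 10000), (1, 6031 / 10000), (1, 6289 / 10000), (1, 6547 / 10000), (1, 6805 / 10000),
    (1, 7063 / 10000), (1, 7321 / 10000), (2, 183 / 500), (2, 5843 / 15000), (2, 1549 / 3750),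
    (2, 2183 / 5000), (3, 2909 / 10000), (3, 38 / 125)]

/-- A positive vector that the discretized transfer operator contracts. -/
def meshWeight (i : Fin 13) : ℚ :=
  ![1587011, 1567969, 1549366, 1531147, 1513378, 1495981, 1478934, 2010613, 1987575, 1964993,
    1942972, 1005046, 1000000] i / 10 ^ 6

/-- For each mesh point `(d, x)` and each digit `a` compatible with `d`: the digit `a`, the index
`j` of the mesh interval containing `1 / (a + x)`, and `10 ^ 8` times an upper bound for
`(a + x) ^ (-256 / 223)`. -/
def meshRow : Fin 13 → List (ℕ × Fin 12 × ℕ) :=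
  ![[(1, 2, 59264953), (2, 7, 33727955)], [(1, 1, 58171318), (2, 7, 33344482)],
    [(1, 1, 57114847), (2, 7, 32969087)], [(1, 1, 56093717), (2, 7, 32601523)],
    [(1, 0, 55106222), (2, 7, 32241553)], [(1, 0, 54150764), (2, 7, 31888949)],
    [(1, 0, 53225841), (2, 7, 31543492)],
    [(1, 5, 69904484), (2, 9, 37208127), (3, 11, 24824613)],
    [(1, 5, 68547086), (2, 9, 36787762), (3, 11, 24626853)],
    [(1, 5, 67238185), (2, 9, 36376198), (3, 11, 24432021)],
    [(1, 4, 65975283), (2, 8, 35973165), (3, 11, 24240053)],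
    [(2, 9, 38611745), (3, 11, 25476047)], [(2, 9, 38359827), (3, 11, 25360124)]]

/-- The linear interpolation of `v` between mesh points `j` and `j + 1`, evaluated at `y`. -/
def interpolate (v : Fin 13 → ℚ) (j : Fin 12) (y : ℚ) : ℚ :=
  (((meshPoint j.succ).2 - y) * v j.castSucc + (y - (meshPoint j.castSucc).2) * v j.succ) /
    ((meshPoint j.succ).2 - (meshPoint j.castSucc).2)

lemma meshRow_digits : ∀ i,
    (meshRow i).map Prod.fst = [1, 2, 3].filter (· * (meshPoint i).1 ≠ 3) := by
  decide +kernel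

lemma meshRow_spec : ∀ i, 0 ≤ (meshPoint i).2 ∧ 1 ≤ meshWeight i ∧ ∀ r ∈ meshRow i,
    1 ≤ r.1 ∧ (meshPoint r.2.1.castSucc).1 = r.1 ∧ (meshPoint r.2.1.succ).1 = r.1 ∧
    (meshPoint r.2.1.castSucc).2 < (meshPoint r.2.1.succ).2 ∧
    (meshPoint r.2.1.castSucc).2 ≤ 1 / (r.1 + (meshPoint i).2) ∧
    1 / (r.1 + (meshPoint i).2) ≤ (meshPoint r.2.1.succ).2 ∧
    1 ≤ (r.2.2 / 10 ^ 8 : ℚ) ^ 223 * (r.1 + (meshPoint i).2) ^ 256 := by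
  decide +kernel

lemma meshRow_contracts : ∀ i,
    ((meshRow i).map fun r => (r.2.2 / 10 ^ 8 : ℚ) *
      interpolate meshWeight r.2.1 (1 / (r.1 + (meshPoint i).2))).sum ≤
      (1 - 1 / 10 ^ 5) * meshWeight i := by
  decide +kernel

lemma rpow_neg_le_of_one_le_pow_mul_pow {b u : ℝ} (hb : 0 < b) (hu : 0 ≤ u) {m n : ℕ} (hn : n ≠ 0)
    (h : 1 ≤ u ^ n * b ^ m) : b ^ (-(m / n : ℝ)) ≤ u := by
  refine le_of_pow_le_pow_left₀ hn hu ?_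
  rw [← Real.rpow_natCast (b ^ _), ← Real.rpow_mul hb.le, neg_mul,
    div_mul_cancel₀ _ (by exact_mod_cast hn), Real.rpow_neg hb.le, Real.rpow_natCast]
  exact (inv_le_iff_one_le_mul₀ (by positivity)).2 h

lemma ConvexOn.le_interpolate {f : ℝ → ℝ} (hf : ConvexOn ℝ (Set.Ici 0) f) {x y z : ℝ} (hx : 0 ≤ x)
    (hxz : x < z) (hxy : x ≤ y) (hyz : y ≤ z) :
    f y ≤ ((z - y) * f x + (y - x) * f z) / (z - x) := by
  have hpos : 0 < z - x := sub_pos.2 hxz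
  have := hf.2 hx (hx.trans hxz.le : (0 : ℝ) ≤ z) (div_nonneg (sub_nonneg.2 hyz) hpos.le)
    (div_nonneg (sub_nonneg.2 hxy) hpos.le) (by field_simp; ring)
  have e : ((z - y) / (z - x)) • x + ((y - x) / (z - x)) • z = y := by
    simp only [smul_eq_mul]
    field_simp
    ring
  rw [e] at this
  refine this.trans_eq ?_
  simp only [smul_eq_mul]
  ring

lemma scaleSum_meshPoint_le (n : ℕ) (i : Fin 13) :
    scaleSum (256 / 223) n (meshPoint i).1 (meshPoint i).2 ≤
      (1 - 1 / 10 ^ 5) ^ n * (meshWeight i : ℝ) := by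
  induction n generalizing i with
  | zero =>
    have : (1 : ℝ) ≤ meshWeight i := by exact_mod_cast (meshRow_spec i).2.1
    simpa [scaleSum, cfWords, cfScale] using this
  | succ n ih =>
    obtain ⟨hx, -, hrow⟩ := meshRow_spec i
    have hx' : (0 : ℝ) ≤ (meshPoint i).2 := by exact_mod_cast hx
    have hcon := (Rat.cast_le (K := ℝ)).2 (meshRow_contracts i)
    have hρ : ((1 - 1 / 10 ^ 5 : ℚ) : ℝ) = 1 - 1 / 10 ^ 5 := by norm_num
    rw [Rat.cast_list_sum, List.map_map, Rat.cast_mul, hρ] at hcon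
    rw [scaleSum_succ _ _ _ hx', ← meshRow_digits, List.map_map, pow_succ, mul_assoc]
    refine le_trans ?_ (mul_le_mul_of_nonneg_left hcon (by norm_num))
    rw [← List.sum_map_mul_left]
    refine List.sum_le_sum fun r hr => ?_
    obtain ⟨h1, hd, hd', hlt, hle, hle', hpow⟩ := hrow r hr
    have h1' : (1 : ℝ) ≤ r.1 := by exact_mod_cast h1
    have hb : (0 : ℝ) < r.1 + (meshPoint i).2 := by linarith
    have hlt' : ((meshPoint r.2.1.castSucc).2 : ℝ) < (meshPoint r.2.1.succ).2 := by
      exact_mod_cast hlt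
    have hy : ((meshPoint r.2.1.castSucc).2 : ℝ) ≤ 1 / (r.1 + (meshPoint i).2) := by
      exact_mod_cast hle
    have hy' : 1 / (r.1 + (meshPoint i).2) ≤ ((meshPoint r.2.1.succ).2 : ℝ) := by
      exact_mod_cast hle'
    have hu : (r.1 + (meshPoint i).2 : ℝ) ^ (-(256 / 223) : ℝ) ≤ r.2.2 / 10 ^ 8 := by
      have hpow' := (Rat.cast_le (K := ℝ)).2 hpow
      push_cast at hpow'
      exact_mod_cast rpow_neg_le_of_one_le_pow_mul_pow (m := 256) (n := 223) hb (by positivity)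
        (by norm_num) hpow'
    have hx0 : (0 : ℝ) ≤ (meshPoint r.2.1.castSucc).2 := by
      exact_mod_cast (meshRow_spec r.2.1.castSucc).1
    have hconv := (convexOn_scaleSum (p := 256 / 223) (by norm_num) n r.1).le_interpolate
      hx0 hlt' hy hy'
    have ih1 := ih r.2.1.castSucc
    have ih2 := ih r.2.1.succ
    rw [hd] at ih1
    rw [hd'] at ih2
    simp only [Function.comp_apply]
    have hI : scaleSum (256 / 223) n r.1 (1 / (r.1 + (meshPoint i).2)) ≤ (1 - 1 / 10 ^ 5) ^ n *
        (interpolate meshWeight r.2.1 (1 / (r.1 + (meshPoint i).2)) : ℝ) := by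
      refine hconv.trans ?_
      simp only [interpolate]
      push_cast
      rw [← mul_div_assoc]
      refine div_le_div_of_nonneg_right ?_ (sub_pos.2 hlt').le
      linarith [mul_le_mul_of_nonneg_left ih1 (sub_nonneg.2 hy'),
        mul_le_mul_of_nonneg_left ih2 (sub_nonneg.2 hy)]
    refine (mul_le_mul hu hI (scaleSum_nonneg _ _ _ (by positivity)) (by positivity)).trans_eq ?_
    push_cast
    ring

lemma dimH_gaussCantor_lt :
    dimH (gaussCantor {1, 2, 3} forbiddenC2) < ENNReal.ofReal 0.574 := by
  have hlim : Tendsto (fun n => scaleSum (256 / 223) n 2 ((183 / 500 : ℚ) : ℝ)) atTop (nhds 0) := by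
    refine squeeze_zero (fun n => scaleSum_nonneg _ _ _ (by norm_num))
      (fun n => scaleSum_meshPoint_le n 7) ?_
    simpa using (tendsto_pow_atTop_nhds_zero_of_lt_one (by norm_num : (0 : ℝ) ≤ 1 - 1 / 10 ^ 5)
      (by norm_num)).mul_const _
  have hs : (2 * ((128 / 223 : NNReal) : ℝ)) = 256 / 223 := by
    push_cast
    norm_num
  refine (dimH_gaussCantor_le (s := 128 / 223) (y := ((183 / 500 : ℚ) : ℝ)) (by norm_num)
    (by norm_num) (by rwa [hs])).trans_lt ?_
  rw [ENNReal.ofReal, ENNReal.coe_lt_coe, ← NNReal.coe_lt_coe, Real.coe_toNNReal _ (by norm_num)]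
  push_cast
  norm_num

/-- `dim_H ((M \ L) ∩ (√13, 3.84)) ≤ dim_H K(C₂) < 0.574`, where `K(C₂)` is the set of reals
with continued fraction partial quotients in `{1,2,3}` avoiding `13` and `31`. -/
theorem dimH_MminusL_sqrt13_384 :
    dimH ((MarkovSpectrum \ LagrangeSpectrum) ∩ Set.Ioo (Real.sqrt 13) 3.84) ≤
      dimH (gaussCantor {1, 2, 3} forbiddenC2) ∧
    dimH (gaussCantor {1, 2, 3} forbiddenC2) < ENNReal.ofReal 0.574 := by
  exact ⟨dimH_diff_le, dimH_gaussCantor_lt⟩
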